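/- arXiv:1011.1401 — 8 statements merged into one kernel-verified Lean document; each statement's English description precedes it below -/
import Mathlib

section
/- Assume γ₂·p₊·p₋ ≠ 0 (so that in particular A < 1 and D(p) := √( (p₊²+p₋²)² − 4·A·p₊²·p₋² ) > 0). Define the 2×2 matrix U(p) with entries, for s, s' ∈ {+1,−1}, U(p)_{s,s'} = ( δ_{s,s'} − sgn(γ₂·p₊·p₋)·s·(1−δ_{s,s'}) )·√( (1 + s·s'·(p₊²−p₋²)/D(p)) / 2 ). Then U(p) is an orthogonal matrix and U(p)ᵀ·M(p)·U(p) is the diagonal matrix with diagonal entries ω₊(p)² (in the (+1,+1) slot) and ω₋(p)² (in the (−1,−1) slot). (This is the explicit orthogonal diagonalization, given by equation (U) of the paper, used to diagonalize the Mattis Hamiltonian in Theorem 3.1.) -/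
/-- The boson dispersion relation ω₊ of the Mattis model. -/
noncomputable def omegaP (A vF' : ℝ) (p : ℝ × ℝ) : ℝ :=
  vF' * Real.sqrt (((p.1 ^ 2 + p.2 ^ 2) +
    Real.sqrt ((p.1 ^ 2 + p.2 ^ 2) ^ 2 - 4 * A * p.1 ^ 2 * p.2 ^ 2)) / 2)

/-- The boson dispersion relation ω₋ of the Mattis model. -/
noncomputable def omegaM (A vF' : ℝ) (p : ℝ × ℝ) : ℝ :=
  vF' * Real.sqrt (((p.1 ^ 2 + p.2 ^ 2) -
    Real.sqrt ((p.1 ^ 2 + p.2 ^ 2) ^ 2 - 4 * A * p.1 ^ 2 * p.2 ^ 2)) / 2)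

/-- The 2×2 symmetric matrix `M(p)`, with index `0 : Fin 2` corresponding to `s = +1`
(component `p₊`) and `1 : Fin 2` corresponding to `s = −1` (component `p₋`). -/
noncomputable def mattisMat (γ₁ γ₂ vF : ℝ) (p : ℝ × ℝ) : Matrix (Fin 2) (Fin 2) ℝ :=
  fun i j => vF ^ 2 * (1 - γ₁) * (if i = j then 1 + γ₁ else γ₂) *
    (if i = 0 then p.1 else p.2) * (if j = 0 then p.1 else p.2)

/-- The orthogonal matrix `U(p)` with entries
`U(p)_{s,s'} = (δ_{s,s'} − sgn(γ₂·p₊·p₋)·s·(1−δ_{s,s'}))·√((1 + s·s'·(p₊²−p₋²)/D(p))/2)`,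
where `D(p) = √((p₊²+p₋²)² − 4·A·p₊²·p₋²)`; index `0 : Fin 2` means `s = +1`,
index `1 : Fin 2` means `s = −1`. -/
noncomputable def mattisU (A γ₂ : ℝ) (p : ℝ × ℝ) : Matrix (Fin 2) (Fin 2) ℝ :=
  fun i j =>
    ((if i = j then 1 else 0) -
        Real.sign (γ₂ * p.1 * p.2) * (if i = 0 then (1 : ℝ) else -1) *
          (1 - if i = j then 1 else 0)) *
      Real.sqrt ((1 + (if i = 0 then (1 : ℝ) else -1) * (if j = 0 then (1 : ℝ) else -1) *
        (p.1 ^ 2 - p.2 ^ 2) /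
          Real.sqrt ((p.1 ^ 2 + p.2 ^ 2) ^ 2 - 4 * A * p.1 ^ 2 * p.2 ^ 2)) / 2)

/-- The sign of a positive multiple of `r`, times the absolute value of `r`, is `r`. -/
theorem sign_mul_abs_of_pos_mul {r k : ℝ} (hk : 0 < k) :
    Real.sign (k * r) * |r| = r := by
  rcases lt_trichotomy r 0 with h | h | h
  · rw [Real.sign_of_neg (mul_neg_of_pos_of_neg hk h), abs_of_neg h]; ring
  · simp [h]
  · rw [Real.sign_of_pos (mul_pos hk h), abs_of_pos h]; ring

open Matrix in
theorem stmt_3 (γ₁ γ₂ vF A vF' : ℝ)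
    (hγ₁ : |γ₁| < 1) (hγ₂ : |γ₂| < 1 + γ₁) (hvF : 0 < vF)
    (hA : A = 1 - (γ₂ / (1 + γ₁)) ^ 2)
    (hvF' : vF' = vF * Real.sqrt (1 - γ₁ ^ 2))
    (p : ℝ × ℝ) (hp : γ₂ * p.1 * p.2 ≠ 0) :
    A < 1 ∧
    0 < Real.sqrt ((p.1 ^ 2 + p.2 ^ 2) ^ 2 - 4 * A * p.1 ^ 2 * p.2 ^ 2) ∧
    (mattisU A γ₂ p)ᵀ * mattisU A γ₂ p = 1 ∧
    (mattisU A γ₂ p)ᵀ * mattisMat γ₁ γ₂ vF p * mattisU A γ₂ p =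
      Matrix.diagonal ![omegaP A vF' p ^ 2, omegaM A vF' p ^ 2] := by
  obtain ⟨P, Q⟩ := p
  simp only at hp ⊢
  have hg₁ : 0 < 1 + γ₁ := (abs_nonneg _).trans_lt hγ₂
  obtain ⟨hγl, hγr⟩ := abs_lt.mp hγ₁
  have hne : γ₂ ≠ 0 := by rintro rfl; simp at hp
  have hP : P ≠ 0 := by rintro rfl; simp at hp
  have hQ : Q ≠ 0 := by rintro rfl; simp at hp
  obtain ⟨g, hg⟩ : ∃ g, g = γ₂ / (1 + γ₁) := ⟨_, rfl⟩
  have hγg : γ₂ = g * (1 + γ₁) := by rw [hg]; field_simp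
  have hg0 : g ≠ 0 := by rintro rfl; simp [hγg] at hne
  have hg2 : 0 < g ^ 2 := by positivity
  have hg1 : g ^ 2 < 1 := by
    rw [sq_lt_one_iff_abs_lt_one, hg, abs_div, abs_of_pos hg₁]
    exact (div_lt_one hg₁).mpr hγ₂
  rw [← hg] at hA
  have hX : (P ^ 2 + Q ^ 2) ^ 2 - 4 * A * P ^ 2 * Q ^ 2 =
      (P ^ 2 - Q ^ 2) ^ 2 + 4 * (g * P * Q) ^ 2 := by rw [hA]; ring
  have hXpos : 0 < (P ^ 2 + Q ^ 2) ^ 2 - 4 * A * P ^ 2 * Q ^ 2 := by rw [hX]; positivity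
  have hA1 : A < 1 := by linarith
  have hD := Real.sqrt_pos.mpr hXpos
  refine ⟨hA1, hD, ?_⟩
  have hD2 := Real.sq_sqrt hXpos.le
  have hDle : √((P ^ 2 + Q ^ 2) ^ 2 - 4 * A * P ^ 2 * Q ^ 2) ≤ P ^ 2 + Q ^ 2 := by
    have hA0 : 0 ≤ A := by linarith
    refine Real.sqrt_le_iff.mpr ⟨by positivity, sub_le_self _ (by positivity)⟩
  have hM : mattisMat γ₁ γ₂ vF (P, Q) =
      (vF ^ 2 * (1 - γ₁ ^ 2)) • !![P ^ 2, g * P * Q; g * P * Q, Q ^ 2] := by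
    ext i j
    fin_cases i <;> fin_cases j <;> simp [mattisMat, hγg] <;> ring
  simp only [omegaP, omegaM]
  generalize hDdef : √((P ^ 2 + Q ^ 2) ^ 2 - 4 * A * P ^ 2 * Q ^ 2) = D at hD hD2 hDle ⊢
  rw [hX] at hD2
  obtain ⟨x, hx⟩ : ∃ x, x = (P ^ 2 - Q ^ 2) / D := ⟨_, rfl⟩
  have hx2 : 1 - x ^ 2 = (2 * (g * P * Q / D)) ^ 2 := by
    rw [hx]; field_simp; linarith
  obtain ⟨hxl, hxr⟩ : -1 ≤ x ∧ x ≤ 1 := by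
    rw [← abs_le, ← sq_le_one_iff_abs_le_one]
    linarith [sq_nonneg (2 * (g * P * Q / D))]
  have hc := Real.sq_sqrt (show 0 ≤ (1 + x) / 2 by linarith)
  have hs := Real.sq_sqrt (show 0 ≤ (1 - x) / 2 by linarith)
  have hσ2 : Real.sign (γ₂ * P * Q) ^ 2 = 1 := by
    rcases Real.sign_apply_eq_of_ne_zero _ hp with h | h <;> rw [h] <;> norm_num
  have hσ : Real.sign (γ₂ * P * Q) * (√((1 + x) / 2) * √((1 - x) / 2)) = g * P * Q / D := by
    rw [← Real.sqrt_mul (by linarith),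
      show (1 + x) / 2 * ((1 - x) / 2) = (g * P * Q / D) ^ 2 by linarith,
      Real.sqrt_sq_eq_abs,
      show γ₂ * P * Q = ((1 + γ₁) * D) * (g * P * Q / D) by rw [hγg]; field_simp]
    exact sign_mul_abs_of_pos_mul (by positivity)
  have hv : vF' ^ 2 = vF ^ 2 * (1 - γ₁ ^ 2) := by
    rw [hvF', mul_pow, Real.sq_sqrt (by nlinarith)]
  have hp2 := Real.sq_sqrt (show 0 ≤ (P ^ 2 + Q ^ 2 + D) / 2 by positivity)
  have hm2 := Real.sq_sqrt (show 0 ≤ (P ^ 2 + Q ^ 2 - D) / 2 by linarith)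
  have hxD : x * D = P ^ 2 - Q ^ 2 := by rw [hx]; field_simp
  obtain ⟨y, hy⟩ : ∃ y, y = g * P * Q / D := ⟨_, rfl⟩
  have hyD : y * D = g * P * Q := by rw [hy]; field_simp
  rw [← hy] at hσ hx2
  have hU : mattisU A γ₂ (P, Q) =
      !![√((1 + x) / 2), -(Real.sign (γ₂ * P * Q) * √((1 - x) / 2));
        Real.sign (γ₂ * P * Q) * √((1 - x) / 2), √((1 + x) / 2)] := by
    ext i j
    fin_cases i <;> fin_cases j <;>
      simp only [mattisU, hDdef, Fin.zero_eta, Fin.mk_one, Fin.isValue, if_true, zero_ne_one,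
        one_ne_zero, if_false, Matrix.of_apply, Matrix.cons_val', Matrix.cons_val_zero,
        Matrix.cons_val_one,
        Matrix.cons_val_fin_one, one_mul, mul_one, neg_mul, neg_neg, neg_div, mul_neg,
        ← sub_eq_add_neg, ← hx] <;> ring
  rw [hU, hM, mul_pow, mul_pow, hp2, hm2, hv]
  generalize √((1 + x) / 2) = c at *
  have ht : (Real.sign (γ₂ * P * Q) * √((1 - x) / 2)) ^ 2 = (1 - x) / 2 := by
    rw [mul_pow, hσ2, hs, one_mul]
  have hct : c * (Real.sign (γ₂ * P * Q) * √((1 - x) / 2)) = y := by rw [← hσ]; ring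
  generalize Real.sign (γ₂ * P * Q) * √((1 - x) / 2) = t at *
  generalize vF ^ 2 * (1 - γ₁ ^ 2) = a
  constructor
  · ext i j
    fin_cases i <;> fin_cases j <;> simp [Matrix.mul_apply, Fin.sum_univ_two]
    · linear_combination hc + ht
    · ring
    · ring
    · linear_combination hc + ht
  · ext i j
    fin_cases i <;> fin_cases j <;> simp [Matrix.mul_apply, Fin.sum_univ_two]
    · linear_combination a * (P ^ 2 * hc + Q ^ 2 * ht + 2 * g * P * Q * hct
        - x / 2 * hxD - 2 * y * hyD - D / 2 * hx2)
    · linear_combination a * (-(P ^ 2 - Q ^ 2) * hct + g * P * Q * (hc - ht)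
        + y * hxD - x * hyD)
    · linear_combination a * (-(P ^ 2 - Q ^ 2) * hct + g * P * Q * (hc - ht)
        + y * hxD - x * hyD)
    · linear_combination a * (P ^ 2 * ht + Q ^ 2 * hc - 2 * g * P * Q * hct
        + x / 2 * hxD + 2 * y * hyD + D / 2 * hx2)
end

section
/- Let β > 0. For every ã > 0 the function p ↦ log(1 − exp(−β·ω₊(p))) + log(1 − exp(−β·ω₋(p))) (defined for almost every p ∈ ℝ², namely for p₊·p₋ ≠ 0) is Lebesgue integrable on the square [−π/ã, π/ã]², and lim_{ã→0⁺} (ã/(β·(2π)²)) · ∫_{[−π/ã,π/ã]²} [ log(1 − exp(−β·ω₊(p))) + log(1 − exp(−β·ω₋(p))) ] d²p = −π/(3·ṽ_F·√A·β²). (This is the quantum-field-theory limit of the renormalized free energy density of the Mattis model, Result 4.1.) -/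
open MeasureTheory

theorem integral_Ioi_log_one_sub_exp {c : ℝ} (hc : 0 < c) :
    ∫ t in Set.Ioi (0 : ℝ), Real.log (1 - Real.exp (-(c * t))) = -(Real.pi ^ 2 / (6 * c)) := by
  set F : ℕ → ℝ → ℝ := fun n t => Real.exp (-(c * (n + 1)) * t) / (n + 1) with hF
  have hint (n : ℕ) : ∫ t in Set.Ioi (0 : ℝ), F n t = c⁻¹ * (1 / ((n + 1 : ℕ) : ℝ) ^ 2) := by
    have hn : -(c * (n + 1)) < 0 := neg_lt_zero.mpr (by positivity)
    simp only [hF, integral_div, integral_exp_mul_Ioi hn]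
    push_cast
    field_simp
    simp
  have hzeta : HasSum (fun n : ℕ => c⁻¹ * (1 / ((n + 1 : ℕ) : ℝ) ^ 2))
      (c⁻¹ * (Real.pi ^ 2 / 6)) := by
    refine HasSum.mul_left _ ?_
    simpa using (hasSum_nat_add_iff' 1).mpr hasSum_zeta_two
  have hsum := hasSum_integral_of_summable_integral_norm (F := F)
    (μ := volume.restrict (Set.Ioi (0 : ℝ)))
    (fun n => (integrableOn_exp_mul_Ioi (neg_lt_zero.mpr (by positivity)) 0).div_const _) (by
      refine hzeta.summable.congr fun n => ?_
      rw [← hint n]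
      refine integral_congr_ae (.of_forall fun t => ?_)
      simp only [hF]
      rw [Real.norm_of_nonneg (by positivity)])
  simp only [hint] at hsum
  have heq : ∫ t in Set.Ioi (0 : ℝ), ∑' n, F n t =
      ∫ t in Set.Ioi (0 : ℝ), -Real.log (1 - Real.exp (-(c * t))) := by
    refine setIntegral_congr_fun measurableSet_Ioi fun t ht => ?_
    have hct : 0 < c * t := mul_pos hc ht
    have habs : |Real.exp (-(c * t))| < 1 := by
      rw [abs_of_pos (Real.exp_pos _), Real.exp_lt_one_iff]
      linarith
    rw [← (Real.hasSum_pow_div_log_of_abs_lt_one habs).tsum_eq]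
    refine tsum_congr fun n => ?_
    simp only [hF]
    rw [← Real.exp_nat_mul]
    push_cast
    ring_nf
  rw [heq, integral_neg] at hsum
  have := hsum.unique hzeta
  rw [neg_eq_iff_eq_neg] at this
  rw [this]
  field_simp

theorem integral_log_one_sub_exp_abs {c : ℝ} (hc : 0 < c) :
    ∫ t : ℝ, Real.log (1 - Real.exp (-(c * |t|))) = -(Real.pi ^ 2 / (3 * c)) := by
  rw [integral_comp_abs (f := fun t => Real.log (1 - Real.exp (-(c * t)))),
    integral_Ioi_log_one_sub_exp hc]
  field_simp
  norm_num

theorem integrable_log_one_sub_exp_abs {c : ℝ} (hc : 0 < c) :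
    Integrable fun t : ℝ => Real.log (1 - Real.exp (-(c * |t|))) := by
  refine .of_integral_ne_zero ?_
  rw [integral_log_one_sub_exp_abs hc]
  exact (neg_neg_of_pos (by positivity)).ne

theorem abs_log_one_sub_exp_le {s t : ℝ} (hs : 0 < s) (hst : s ≤ t) :
    |Real.log (1 - Real.exp (-t))| ≤ |Real.log (1 - Real.exp (-s))| := by
  have hs1 : Real.exp (-s) < 1 := Real.exp_lt_one_iff.mpr (by linarith)
  have hts : Real.exp (-t) ≤ Real.exp (-s) := Real.exp_le_exp.mpr (by linarith)
  have := Real.exp_pos (-t)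
  rw [abs_of_nonpos (Real.log_nonpos (by linarith) (by linarith)),
    abs_of_nonpos (Real.log_nonpos (by linarith) (by linarith [Real.exp_pos (-s)]))]
  exact neg_le_neg (Real.log_le_log (by linarith) (by linarith))

theorem tendsto_inv_mul_setIntegral_square {Φ : ℝ × ℝ → ℝ} {G h : ℝ → ℝ}
    (hΦ : Measurable Φ) (hG : Integrable G)
    (hsupp : ∀ x y : ℝ, |x| < |y| → Φ (x, y) = 0)
    (hbound : ∀ x y : ℝ, y ≠ 0 → |Φ (x, y)| ≤ G y)
    (hlim : ∀ y : ℝ, y ≠ 0 →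
      Filter.Tendsto (fun x => Φ (x, y)) (Filter.comap (fun x : ℝ => |x|) Filter.atTop)
        (nhds (h y))) :
    (∀ L : ℝ, IntegrableOn Φ (Set.Icc (-L) L ×ˢ Set.Icc (-L) L)) ∧
    Filter.Tendsto (fun L : ℝ => L⁻¹ * ∫ p in Set.Icc (-L) L ×ˢ Set.Icc (-L) L, Φ p)
      Filter.atTop (nhds (2 * ∫ y, h y)) := by
  have hae : ∀ᵐ y : ℝ, y ≠ 0 := by simp [ae_iff, measure_singleton]
  have hintegrable (L : ℝ) : IntegrableOn Φ (Set.Icc (-L) L ×ˢ Set.Icc (-L) L) := by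
    have hGint : Integrable (fun p : ℝ × ℝ => G p.2)
        ((volume.restrict (Set.Icc (-L) L)).prod (volume.restrict (Set.Icc (-L) L))) :=
      hG.restrict.comp_snd _
    rw [IntegrableOn, Measure.volume_eq_prod, ← Measure.prod_restrict]
    refine hGint.mono' hΦ.aestronglyMeasurable ?_
    filter_upwards [Measure.quasiMeasurePreserving_snd.ae (ae_restrict_of_ae hae)] with p hp
    exact hbound p.1 p.2 hp
  refine ⟨hintegrable, ?_⟩
  have hinner : Filter.Tendsto (fun x => ∫ y, Φ (x, y))
      (Filter.comap (fun x : ℝ => |x|) Filter.atTop) (nhds (∫ y, h y)) := by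
    refine tendsto_integral_filter_of_dominated_convergence G
      (.of_forall fun x => (hΦ.comp measurable_prodMk_left).aestronglyMeasurable)
      (.of_forall fun x => ?_) hG ?_
    · filter_upwards [hae] with y hy using hbound x y hy
    · filter_upwards [hae] with y hy using hlim y hy
  have hinner_le (x : ℝ) : ‖∫ y, Φ (x, y)‖ ≤ ∫ y, G y := by
    refine norm_integral_le_of_norm_le hG ?_
    filter_upwards [hae] with y hy using hbound x y hy
  have houter : Filter.Tendsto
      (fun L : ℝ => ∫ u in Set.Icc (-1 : ℝ) 1, ∫ y, Φ (L * u, y)) Filter.atTop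
      (nhds (∫ _ in Set.Icc (-1 : ℝ) 1, ∫ y, h y)) := by
    refine tendsto_integral_filter_of_dominated_convergence (fun _ => ∫ y, G y)
      (.of_forall fun L => ?_) (.of_forall fun L => .of_forall fun u => hinner_le _)
      (integrable_const _) ?_
    · have hm : StronglyMeasurable fun x => ∫ y, Φ (x, y) :=
        StronglyMeasurable.integral_prod_right (f := fun x y => Φ (x, y)) hΦ.stronglyMeasurable
      exact (hm.comp_measurable (measurable_const_mul L)).aestronglyMeasurable
    · filter_upwards [ae_restrict_of_ae hae] with u hu
      refine hinner.comp (Filter.tendsto_comap_iff.mpr ?_)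
      simp only [Function.comp_def, abs_mul]
      exact Filter.tendsto_abs_atTop_atTop.atTop_mul_const (abs_pos.mpr hu)
  have hconst : ∫ _ in Set.Icc (-1 : ℝ) 1, ∫ y, h y = 2 * ∫ y, h y := by
    simp [Measure.real]
    norm_num
  rw [hconst] at houter
  refine houter.congr' ?_
  filter_upwards [Filter.eventually_gt_atTop 0] with L hL
  have hscale := Measure.setIntegral_comp_smul_of_pos volume (fun x => ∫ y, Φ (x, y))
    (Set.Icc (-1 : ℝ) 1) hL
  simp only [smul_eq_mul, Module.finrank_self, pow_one, LinearOrderedField.smul_Icc hL,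
    mul_neg, mul_one] at hscale
  rw [hscale, Measure.volume_eq_prod, setIntegral_prod _ (hintegrable L)]
  congr 1
  refine setIntegral_congr_fun measurableSet_Icc fun x hx => ?_
  refine (setIntegral_eq_integral_of_forall_compl_eq_zero fun y hy => hsupp x y ?_).symm
  rw [Set.mem_Icc, ← abs_le, not_le] at hy
  exact (abs_le.mpr hx).trans_lt hy

theorem omegaM_le_omegaP {v : ℝ} (A : ℝ) (hv : 0 ≤ v) (p : ℝ × ℝ) :
    omegaM A v p ≤ omegaP A v p := by
  unfold omegaM omegaP
  gcongr
  have := Real.sqrt_nonneg ((p.1 ^ 2 + p.2 ^ 2) ^ 2 - 4 * A * p.1 ^ 2 * p.2 ^ 2)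
  linarith

theorem omegaM_le {A v : ℝ} (hA0 : 0 ≤ A) (hA1 : A ≤ 1) (hv : 0 ≤ v) (x y : ℝ) :
    omegaM A v (x, y) ≤ v * (√A * |y|) := by
  unfold omegaM
  rw [← Real.sqrt_sq_eq_abs, ← Real.sqrt_mul hA0]
  gcongr
  have h : x ^ 2 + y ^ 2 - 2 * (A * y ^ 2) ≤ √((x ^ 2 + y ^ 2) ^ 2 - 4 * A * x ^ 2 * y ^ 2) := by
    refine Real.le_sqrt_of_sq_le ?_
    have : 0 ≤ A * (1 - A) * (y ^ 2) ^ 2 :=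
      mul_nonneg (mul_nonneg hA0 (sub_nonneg.mpr hA1)) (sq_nonneg _)
    nlinarith
  simp only
  linarith

theorem le_omegaM {A v : ℝ} (hA1 : A ≤ 1) (hv : 0 ≤ v) (x y : ℝ) :
    v * √(A * x ^ 2 * y ^ 2 / (x ^ 2 + y ^ 2)) ≤ omegaM A v (x, y) := by
  unfold omegaM
  refine mul_le_mul_of_nonneg_left (Real.sqrt_le_sqrt ?_) hv
  simp only
  rcases (by positivity : 0 ≤ x ^ 2 + y ^ 2).eq_or_lt with hs | hs
  · have hx : x = 0 := by nlinarith [sq_nonneg x, sq_nonneg y]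
    have hy : y = 0 := by nlinarith [sq_nonneg x, sq_nonneg y]
    simp [hx, hy]
  have hxy : A * x ^ 2 * y ^ 2 ≤ x ^ 2 * y ^ 2 := by
    have : 0 ≤ x ^ 2 * y ^ 2 := by positivity
    nlinarith
  have hle : 2 * (A * x ^ 2 * y ^ 2 / (x ^ 2 + y ^ 2)) ≤ x ^ 2 + y ^ 2 := by
    rw [← mul_div_assoc, div_le_iff₀ hs]
    nlinarith [sq_nonneg (x ^ 2), sq_nonneg (y ^ 2)]
  have h : √((x ^ 2 + y ^ 2) ^ 2 - 4 * A * x ^ 2 * y ^ 2) ≤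
      x ^ 2 + y ^ 2 - 2 * (A * x ^ 2 * y ^ 2 / (x ^ 2 + y ^ 2)) := by
    refine Real.sqrt_le_iff.mpr ⟨by linarith, ?_⟩
    have hmul : (x ^ 2 + y ^ 2) * (A * x ^ 2 * y ^ 2 / (x ^ 2 + y ^ 2)) = A * x ^ 2 * y ^ 2 :=
      mul_div_cancel₀ _ hs.ne'
    nlinarith [sq_nonneg (A * x ^ 2 * y ^ 2 / (x ^ 2 + y ^ 2))]
  linarith

theorem le_omegaM_of_abs_le {A v : ℝ} (hA0 : 0 ≤ A) (hA1 : A ≤ 1) (hv : 0 ≤ v) {x y : ℝ}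
    (hy : y ≠ 0) (hyx : |y| ≤ |x|) : v * √(A / 2) * |y| ≤ omegaM A v (x, y) := by
  refine le_trans ?_ (le_omegaM hA1 hv x y)
  rw [mul_assoc, ← Real.sqrt_sq_eq_abs y, ← Real.sqrt_mul (by positivity)]
  gcongr
  have hsq : y ^ 2 ≤ x ^ 2 := sq_le_sq.mpr hyx
  rw [le_div_iff₀ (by positivity)]
  have : 0 ≤ A * y ^ 2 * (x ^ 2 - y ^ 2) :=
    mul_nonneg (by positivity) (sub_nonneg.mpr hsq)
  nlinarith

theorem le_omegaP {v : ℝ} (A : ℝ) (hv : 0 ≤ v) (x y : ℝ) :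
    v * √(1 / 2) * |x| ≤ omegaP A v (x, y) := by
  unfold omegaP
  rw [mul_assoc, ← Real.sqrt_sq_eq_abs x, ← Real.sqrt_mul (by positivity)]
  gcongr
  have := Real.sqrt_nonneg ((x ^ 2 + y ^ 2) ^ 2 - 4 * A * x ^ 2 * y ^ 2)
  simp only
  nlinarith [sq_nonneg y]

theorem tendsto_omegaP {v : ℝ} (A : ℝ) (hv : 0 < v) (y : ℝ) :
    Filter.Tendsto (fun x => omegaP A v (x, y))
      (Filter.comap (fun x : ℝ => |x|) Filter.atTop) Filter.atTop :=
  Filter.tendsto_atTop_mono (fun x => le_omegaP A hv.le x y)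
    (Filter.tendsto_comap.const_mul_atTop (by positivity))

theorem tendsto_omegaM {A v : ℝ} (hA0 : 0 ≤ A) (hA1 : A ≤ 1) (hv : 0 ≤ v) (y : ℝ) :
    Filter.Tendsto (fun x => omegaM A v (x, y))
      (Filter.comap (fun x : ℝ => |x|) Filter.atTop) (nhds (v * (√A * |y|))) := by
  refine tendsto_of_tendsto_of_tendsto_of_le_of_le ?_ tendsto_const_nhds
    (fun x => le_omegaM hA1 hv x y) (fun x => omegaM_le hA0 hA1 hv x y)
  refine Filter.Tendsto.const_mul _ ?_
  rw [← Real.sqrt_sq_eq_abs y, ← Real.sqrt_mul hA0]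
  refine (Real.continuous_sqrt.tendsto _).comp ?_
  have habs : Filter.Tendsto (fun x : ℝ => |x|)
      (Filter.comap (fun x : ℝ => |x|) Filter.atTop) Filter.atTop := Filter.tendsto_comap
  have hden : Filter.Tendsto (fun x : ℝ => |x| ^ 2 + y ^ 2)
      (Filter.comap (fun x : ℝ => |x|) Filter.atTop) Filter.atTop :=
    Filter.tendsto_atTop_add_const_right _ _
      ((Filter.tendsto_pow_atTop two_ne_zero).comp habs)
  have hlim := (hden.inv_tendsto_atTop.const_mul (A * (y ^ 2) ^ 2)).const_sub (A * y ^ 2)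
  rw [mul_zero, sub_zero] at hlim
  refine hlim.congr' ?_
  filter_upwards [hden.eventually_gt_atTop 0] with x hx
  simp only [sq_abs, Pi.inv_apply] at hx ⊢
  field_simp
  ring

theorem measurable_omegaP (A v : ℝ) : Measurable (omegaP A v) := by
  unfold omegaP
  fun_prop

theorem measurable_omegaM (A v : ℝ) : Measurable (omegaM A v) := by
  unfold omegaM
  fun_prop

theorem omegaP_swap (A v : ℝ) (p : ℝ × ℝ) : omegaP A v p.swap = omegaP A v p := by
  simp only [omegaP, Prod.fst_swap, Prod.snd_swap]
  ring_nf

theorem omegaM_swap (A v : ℝ) (p : ℝ × ℝ) : omegaM A v p.swap = omegaM A v p := by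
  simp only [omegaM, Prod.fst_swap, Prod.snd_swap]
  ring_nf

/-- The integrand of the free energy of the Mattis model. -/
noncomputable def freeEnergyIntegrand (A v β : ℝ) (p : ℝ × ℝ) : ℝ :=
  Real.log (1 - Real.exp (-β * omegaP A v p)) + Real.log (1 - Real.exp (-β * omegaM A v p))

theorem measurable_freeEnergyIntegrand (A v β : ℝ) : Measurable (freeEnergyIntegrand A v β) := by
  have hP := measurable_omegaP A v
  have hM := measurable_omegaM A v
  unfold freeEnergyIntegrand
  fun_prop

theorem freeEnergyIntegrand_swap (A v β : ℝ) (p : ℝ × ℝ) :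
    freeEnergyIntegrand A v β p.swap = freeEnergyIntegrand A v β p := by
  simp only [freeEnergyIntegrand, omegaP_swap, omegaM_swap]

theorem abs_freeEnergyIntegrand_le {A v β : ℝ} (hA0 : 0 < A) (hA1 : A ≤ 1) (hv : 0 < v)
    (hβ : 0 < β) {x y : ℝ} (hy : y ≠ 0) (hyx : |y| ≤ |x|) :
    |freeEnergyIntegrand A v β (x, y)| ≤
      2 * |Real.log (1 - Real.exp (-(β * (v * √(A / 2)) * |y|)))| := by
  have hpos : 0 < β * (v * √(A / 2)) * |y| := by positivity
  have hM : β * (v * √(A / 2)) * |y| ≤ β * omegaM A v (x, y) := by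
    rw [mul_assoc]
    gcongr
    exact le_omegaM_of_abs_le hA0.le hA1 hv.le hy hyx
  have hP : β * (v * √(A / 2)) * |y| ≤ β * omegaP A v (x, y) := by
    refine hM.trans ?_
    gcongr
    exact omegaM_le_omegaP A hv.le _
  simp only [freeEnergyIntegrand, neg_mul]
  rw [two_mul]
  exact (abs_add_le _ _).trans
    (add_le_add (abs_log_one_sub_exp_le hpos hP) (abs_log_one_sub_exp_le hpos hM))

theorem tendsto_freeEnergyIntegrand {A v β : ℝ} (hA0 : 0 < A) (hA1 : A ≤ 1) (hv : 0 < v)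
    (hβ : 0 < β) {y : ℝ} (hy : y ≠ 0) :
    Filter.Tendsto (fun x => freeEnergyIntegrand A v β (x, y))
      (Filter.comap (fun x : ℝ => |x|) Filter.atTop)
      (nhds (Real.log (1 - Real.exp (-(β * v * √A * |y|))))) := by
  have hpos : 0 < β * v * √A * |y| := by positivity
  have hP : Filter.Tendsto (fun x => Real.log (1 - Real.exp (-β * omegaP A v (x, y))))
      (Filter.comap (fun x : ℝ => |x|) Filter.atTop) (nhds 0) := by
    have hexp := Real.tendsto_exp_atBot.comp
      ((tendsto_omegaP A hv y).const_mul_atTop_of_neg (neg_neg_of_pos hβ))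
    have hlog : ContinuousAt Real.log (1 - 0) := Real.continuousAt_log (by norm_num)
    simpa only [sub_zero, Real.log_one] using! hlog.tendsto.comp (hexp.const_sub 1)
  have hM : Filter.Tendsto (fun x => Real.log (1 - Real.exp (-β * omegaM A v (x, y))))
      (Filter.comap (fun x : ℝ => |x|) Filter.atTop)
      (nhds (Real.log (1 - Real.exp (-(β * v * √A * |y|))))) := by
    have hlt : Real.exp (-(β * v * √A * |y|)) < 1 := Real.exp_lt_one_iff.mpr (by linarith)
    have hω := (tendsto_omegaM hA0.le hA1 hv.le y).const_mul (-β)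
    rw [show -β * (v * (√A * |y|)) = -(β * v * √A * |y|) by ring] at hω
    exact (Real.continuousAt_log (by linarith)).tendsto.comp
      (((Real.continuous_exp.tendsto _).comp hω).const_sub 1)
  simpa only [zero_add] using! hP.add hM

theorem tendsto_inv_mul_setIntegral_indicator {A v β : ℝ} (hA0 : 0 < A) (hA1 : A ≤ 1)
    (hv : 0 < v) (hβ : 0 < β) {S : Set (ℝ × ℝ)} (hS : MeasurableSet S)
    (hsub : ∀ x y : ℝ, (x, y) ∈ S → |y| ≤ |x|) (hsup : ∀ x y : ℝ, |y| < |x| → (x, y) ∈ S) :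
    (∀ L : ℝ, IntegrableOn (S.indicator (freeEnergyIntegrand A v β))
      (Set.Icc (-L) L ×ˢ Set.Icc (-L) L)) ∧
    Filter.Tendsto (fun L : ℝ => L⁻¹ * ∫ p in Set.Icc (-L) L ×ˢ Set.Icc (-L) L,
        S.indicator (freeEnergyIntegrand A v β) p)
      Filter.atTop (nhds (-(2 * Real.pi ^ 2 / (3 * (β * v * √A))))) := by
  have hlimit : -(2 * Real.pi ^ 2 / (3 * (β * v * √A))) =
      2 * ∫ y : ℝ, Real.log (1 - Real.exp (-(β * v * √A * |y|))) := by
    rw [integral_log_one_sub_exp_abs (by positivity)]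
    ring
  rw [hlimit]
  refine tendsto_inv_mul_setIntegral_square ((measurable_freeEnergyIntegrand A v β).indicator hS)
    ((integrable_log_one_sub_exp_abs
      (by positivity : 0 < β * (v * √(A / 2)))).abs.const_mul 2)
    (fun x y hxy => Set.indicator_of_notMem (fun h => hxy.not_ge (hsub x y h)) _)
    (fun x y hy => ?_) (fun y hy => ?_)
  · by_cases h : (x, y) ∈ S
    · rw [Set.indicator_of_mem h]
      exact abs_freeEnergyIntegrand_le hA0 hA1 hv hβ hy (hsub x y h)
    · rw [Set.indicator_of_notMem h, abs_zero]
      positivity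
  · refine (tendsto_freeEnergyIntegrand hA0 hA1 hv hβ hy).congr' ?_
    filter_upwards [Filter.tendsto_comap.eventually_gt_atTop |y|] with x hx
    rw [Set.indicator_of_mem (hsup x y hx)]

theorem tendsto_inv_mul_setIntegral_freeEnergyIntegrand {A v β : ℝ} (hA0 : 0 < A) (hA1 : A ≤ 1)
    (hv : 0 < v) (hβ : 0 < β) :
    (∀ L : ℝ, IntegrableOn (freeEnergyIntegrand A v β) (Set.Icc (-L) L ×ˢ Set.Icc (-L) L)) ∧
    Filter.Tendsto (fun L : ℝ => L⁻¹ * ∫ p in Set.Icc (-L) L ×ˢ Set.Icc (-L) L,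
        freeEnergyIntegrand A v β p)
      Filter.atTop (nhds (-(4 * Real.pi ^ 2 / (3 * (β * v * √A))))) := by
  set f := freeEnergyIntegrand A v β with hf
  set S : Set (ℝ × ℝ) := {p | |p.2| ≤ |p.1|}
  set T : Set (ℝ × ℝ) := {p | |p.2| < |p.1|}
  have hS : MeasurableSet S := measurableSet_le (by fun_prop) (by fun_prop)
  have hT : MeasurableSet T := measurableSet_lt (by fun_prop) (by fun_prop)
  obtain ⟨hSi, hSt⟩ := tendsto_inv_mul_setIntegral_indicator hA0 hA1 hv hβ hS
    (fun x y h => h) (fun x y h => h.le)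
  obtain ⟨hTi, hTt⟩ := tendsto_inv_mul_setIntegral_indicator hA0 hA1 hv hβ hT
    (fun x y h => h.le) (fun x y h => h)
  have hsplit : f = fun p => S.indicator f p + T.indicator f p.swap := by
    funext p
    rcases le_or_gt |p.2| |p.1| with h | h
    · rw [Set.indicator_of_mem (show p ∈ S from h),
        Set.indicator_of_notMem (show p.swap ∉ T from h.not_gt), add_zero]
    · rw [Set.indicator_of_notMem (show p ∉ S from h.not_ge),
        Set.indicator_of_mem (show p.swap ∈ T from h), zero_add, hf, freeEnergyIntegrand_swap]
  have hTi' (L : ℝ) : IntegrableOn (fun p => T.indicator f p.swap)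
      (Set.Icc (-L) L ×ˢ Set.Icc (-L) L) := by
    have := hTi L
    rw [IntegrableOn, Measure.volume_eq_prod, ← Measure.prod_restrict] at this ⊢
    exact this.swap
  refine ⟨fun L => hsplit ▸ (hSi L).add (hTi' L), ?_⟩
  have hsum := hSt.add hTt
  rw [show -(2 * Real.pi ^ 2 / (3 * (β * v * √A))) + -(2 * Real.pi ^ 2 / (3 * (β * v * √A))) =
    -(4 * Real.pi ^ 2 / (3 * (β * v * √A))) by ring] at hsum
  refine hsum.congr fun L => ?_
  have hswap : ∫ p in Set.Icc (-L) L ×ˢ Set.Icc (-L) L, T.indicator f p.swap =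
      ∫ p in Set.Icc (-L) L ×ˢ Set.Icc (-L) L, T.indicator f p :=
    setIntegral_prod_swap _ _ _
  rw [← mul_add, ← hswap, ← integral_add (hSi L) (hTi' L)]
  congr 2
  exact hsplit.symm

theorem stmt_7 (γ₁ γ₂ vF A vF' β : ℝ)
    (hγ₁ : |γ₁| < 1) (hγ₂ : |γ₂| < 1 + γ₁) (hvF : 0 < vF)
    (hA : A = 1 - (γ₂ / (1 + γ₁)) ^ 2)
    (hvF' : vF' = vF * Real.sqrt (1 - γ₁ ^ 2))
    (hβ : 0 < β) :
    (∀ a : ℝ, 0 < a →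
      IntegrableOn
        (fun p : ℝ × ℝ =>
          Real.log (1 - Real.exp (-β * omegaP A vF' p)) +
            Real.log (1 - Real.exp (-β * omegaM A vF' p)))
        (Set.Icc (-(Real.pi / a)) (Real.pi / a) ×ˢ
          Set.Icc (-(Real.pi / a)) (Real.pi / a)) volume) ∧
    Filter.Tendsto
      (fun a : ℝ =>
        a / (β * (2 * Real.pi) ^ 2) *
          ∫ p in Set.Icc (-(Real.pi / a)) (Real.pi / a) ×ˢ
              Set.Icc (-(Real.pi / a)) (Real.pi / a),
            (Real.log (1 - Real.exp (-β * omegaP A vF' p)) +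
              Real.log (1 - Real.exp (-β * omegaM A vF' p))))
      (nhdsWithin 0 (Set.Ioi 0))
      (nhds (-(Real.pi / (3 * vF' * Real.sqrt A * β ^ 2)))) := by
  have hA0 : 0 < A := by
    have h1 : 0 < 1 + γ₁ := by linarith [(abs_lt.mp hγ₁).1]
    rw [hA, sub_pos, sq_lt_one_iff_abs_lt_one, abs_div, abs_of_pos h1, div_lt_one h1]
    exact hγ₂
  have hA1 : A ≤ 1 := by
    rw [hA]
    linarith [sq_nonneg (γ₂ / (1 + γ₁))]
  have hv : 0 < vF' := by
    rw [hvF']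
    exact mul_pos hvF (Real.sqrt_pos.mpr (sub_pos.mpr ((sq_lt_one_iff_abs_lt_one _).mpr hγ₁)))
  obtain ⟨hint, hlim⟩ := tendsto_inv_mul_setIntegral_freeEnergyIntegrand hA0 hA1 hv hβ
  refine ⟨fun a _ => hint (Real.pi / a), ?_⟩
  have hL : Filter.Tendsto (fun a : ℝ => Real.pi / a) (nhdsWithin 0 (Set.Ioi 0)) Filter.atTop := by
    simpa only [div_eq_mul_inv] using tendsto_inv_nhdsGT_zero.const_mul_atTop Real.pi_pos
  have hmain := (hlim.comp hL).const_mul (Real.pi / (β * (2 * Real.pi) ^ 2))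
  have hvalue : Real.pi / (β * (2 * Real.pi) ^ 2) *
      -(4 * Real.pi ^ 2 / (3 * (β * vF' * √A))) =
      -(Real.pi / (3 * vF' * Real.sqrt A * β ^ 2)) := by
    have : 0 < √A := Real.sqrt_pos.mpr hA0
    field_simp
    norm_num
  rw [hvalue] at hmain
  refine hmain.congr fun a => ?_
  simp only [Function.comp_apply, freeEnergyIntegrand, inv_div]
  rw [← mul_assoc]
  congr 1
  field_simp
end

section
/- For every real number z > −1, the function x ↦ x^z·log(1 − e^{−x}) is Lebesgue integrable on (0, ∞) and ∫₀^∞ x^z·log(1 − e^{−x}) dx = −Γ(z+1) · ∑_{n=1}^∞ n^{−(z+2)}, where Γ is the Gamma function. (This is equation (D.8) of the paper, used to evaluate the free energy integrals.) -/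
open MeasureTheory

/-- The logarithmic series for `log (1 - e⁻ˣ)`, weighted by `x ^ z`. -/
theorem hasSum_rpow_mul_log_one_sub_exp_neg (z : ℝ) {x : ℝ} (hx : 0 < x) :
    HasSum (fun n : ℕ => -(x ^ z * Real.exp (-(((n : ℝ) + 1) * x)) / ((n : ℝ) + 1)))
      (x ^ z * Real.log (1 - Real.exp (-x))) := by
  have h : |Real.exp (-x)| < 1 := by
    rw [abs_of_pos (Real.exp_pos _)]
    exact Real.exp_lt_one_iff.mpr (neg_lt_zero.mpr hx)
  have hlog := (Real.hasSum_pow_div_log_of_abs_lt_one h).mul_left (-(x ^ z))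
  rw [neg_mul_neg] at hlog
  refine hlog.congr_fun fun n => ?_
  rw [← Real.exp_nat_mul]
  push_cast
  ring_nf

theorem integral_rpow_mul_exp_neg_mul_div {z r : ℝ} (hz : -1 < z) (hr : 0 < r) :
    ∫ x in Set.Ioi (0 : ℝ), x ^ z * Real.exp (-(r * x)) / r =
      Real.Gamma (z + 1) * r ^ (-(z + 2)) := by
  have h := Real.integral_rpow_mul_exp_neg_mul_Ioi (a := z + 1) (by linarith) hr
  rw [add_sub_cancel_right] at h
  rw [integral_div, h, show -(z + 2) = -(z + 1) - 1 by ring, Real.rpow_sub_one hr.ne',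
    Real.rpow_neg hr.le, one_div, Real.inv_rpow hr.le]
  ring

theorem summable_nat_add_one_rpow_neg {p : ℝ} (hp : 1 < p) :
    Summable fun n : ℕ => ((n : ℝ) + 1) ^ (-p) := by
  simpa using (summable_nat_add_iff 1).mpr (Real.summable_nat_rpow.mpr (neg_lt_neg hp))

theorem stmt_8 (z : ℝ) (hz : -1 < z) :
    IntegrableOn (fun x : ℝ => x ^ z * Real.log (1 - Real.exp (-x))) (Set.Ioi 0) volume ∧
    ∫ x in Set.Ioi (0 : ℝ), x ^ z * Real.log (1 - Real.exp (-x)) =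
      -Real.Gamma (z + 1) * ∑' n : ℕ, ((n : ℝ) + 1) ^ (-(z + 2)) := by
  have hsum : Summable fun n : ℕ => ((n : ℝ) + 1) ^ (-(z + 2)) :=
    summable_nat_add_one_rpow_neg (by linarith)
  have hterm (n : ℕ) : ∫ x in Set.Ioi (0 : ℝ),
      x ^ z * Real.exp (-(((n : ℝ) + 1) * x)) / ((n : ℝ) + 1) =
        Real.Gamma (z + 1) * ((n : ℝ) + 1) ^ (-(z + 2)) :=
    integral_rpow_mul_exp_neg_mul_div hz (by positivity)
  have hGamma : 0 < Real.Gamma (z + 1) := Real.Gamma_pos_of_pos (by linarith)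
  have hint (n : ℕ) : IntegrableOn
      (fun x : ℝ => -(x ^ z * Real.exp (-(((n : ℝ) + 1) * x)) / ((n : ℝ) + 1)))
      (Set.Ioi 0) := by
    refine (Integrable.of_integral_ne_zero ?_).neg
    rw [hterm n]
    positivity
  have hnorm : Summable fun n : ℕ => ∫ x in Set.Ioi (0 : ℝ),
      ‖-(x ^ z * Real.exp (-(((n : ℝ) + 1) * x)) / ((n : ℝ) + 1))‖ := by
    refine (hsum.mul_left (Real.Gamma (z + 1))).congr fun n => ?_
    rw [← hterm n]
    refine setIntegral_congr_fun measurableSet_Ioi fun x hx => ?_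
    have hx' : 0 < x := hx
    rw [norm_neg, Real.norm_of_nonneg (by positivity)]
  have hval : ∫ x in Set.Ioi (0 : ℝ), x ^ z * Real.log (1 - Real.exp (-x)) =
      -Real.Gamma (z + 1) * ∑' n : ℕ, ((n : ℝ) + 1) ^ (-(z + 2)) := by
    calc ∫ x in Set.Ioi (0 : ℝ), x ^ z * Real.log (1 - Real.exp (-x))
        = ∫ x in Set.Ioi (0 : ℝ), ∑' n : ℕ,
            -(x ^ z * Real.exp (-(((n : ℝ) + 1) * x)) / ((n : ℝ) + 1)) :=
          setIntegral_congr_fun measurableSet_Ioi fun x hx =>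
            (hasSum_rpow_mul_log_one_sub_exp_neg z hx).tsum_eq.symm
      _ = ∑' n : ℕ, -Real.Gamma (z + 1) * ((n : ℝ) + 1) ^ (-(z + 2)) := by
          rw [← integral_tsum_of_summable_integral_norm hint hnorm]
          simp_rw [integral_neg, hterm, neg_mul]
      _ = _ := tsum_mul_left
  refine ⟨Integrable.of_integral_ne_zero ?_, hval⟩
  rw [hval]
  have hpos : 0 < ∑' n : ℕ, ((n : ℝ) + 1) ^ (-(z + 2)) :=
    hsum.tsum_pos (fun n => by positivity) 0 (by positivity)
  exact mul_ne_zero (neg_ne_zero.mpr hGamma.ne') hpos.ne'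
end

section
/- For all real numbers λ > 0 and μ with 0 ≤ μ ≤ 2πλ, one has ∑_{n ∈ ℤ} exp(−λ·π²·n² + μ·π·|n|) ≤ 1 + 2·exp(−λ·π² + μ·π) + 2·exp(μ²/(4λ)) · ∑_{n=1}^∞ exp(−λ·π²·n²). (This is the one-dimensional theta-sum estimate in the proof of Lemma D.1.) -/
theorem summable_exp_neg_mul_nat_add_one_sq {c : ℝ} (hc : 0 < c) :
    Summable fun n : ℕ ↦ Real.exp (-c * ((n : ℝ) + 1) ^ 2) := by
  refine Summable.of_nonneg_of_le (fun _ ↦ (Real.exp_pos _).le) (fun n ↦ ?_)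
    (Real.summable_exp_nat_mul_iff.mpr (neg_lt_zero.mpr hc))
  have hn : (0 : ℝ) ≤ n := n.cast_nonneg
  exact Real.exp_le_exp.mpr (by nlinarith [mul_nonneg hc.le hn, mul_nonneg hc.le (sq_nonneg (n : ℝ))])

/-- Completing the square in the exponent and using `b ≤ 2 * c`. -/
theorem exp_neg_mul_add_two_sq_le {b c t : ℝ} (hc : 0 < c) (hb : b ≤ 2 * c) (ht : 0 ≤ t) :
    Real.exp (-c * (t + 2) ^ 2 + b * (t + 2)) ≤
      Real.exp (b ^ 2 / (4 * c)) * Real.exp (-c * (t + 1) ^ 2) := by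
  rw [← Real.exp_add, Real.exp_le_exp]
  obtain ⟨a, rfl⟩ : ∃ a, b = 2 * c * a := ⟨b / (2 * c), by field_simp⟩
  have ha : a ≤ 1 := by nlinarith
  have hsq : (2 * c * a) ^ 2 / (4 * c) = c * a ^ 2 := by field_simp; ring
  rw [hsq]
  have h : (t + 1) ^ 2 ≤ (t + 2 - a) ^ 2 := pow_le_pow_left₀ (by linarith) (by linarith) 2
  nlinarith [mul_le_mul_of_nonneg_left h hc.le]

theorem stmt_11 (lam mu : ℝ) (hlam : 0 < lam) (hmu0 : 0 ≤ mu)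
    (hmu : mu ≤ 2 * Real.pi * lam) :
    (∑' n : ℤ, Real.exp (-lam * Real.pi ^ 2 * (n : ℝ) ^ 2 + mu * Real.pi * |(n : ℝ)|)) ≤
      1 + 2 * Real.exp (-lam * Real.pi ^ 2 + mu * Real.pi) +
        2 * Real.exp (mu ^ 2 / (4 * lam)) *
          ∑' n : ℕ, Real.exp (-lam * Real.pi ^ 2 * ((n : ℝ) + 1) ^ 2) := by
  have hpi := Real.pi_pos
  have hc : 0 < lam * Real.pi ^ 2 := by positivity
  have hg : Summable fun n : ℕ ↦ Real.exp (-lam * Real.pi ^ 2 * ((n : ℝ) + 1) ^ 2) := by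
    simpa only [neg_mul] using summable_exp_neg_mul_nat_add_one_sq hc
  have hquot : (mu * Real.pi) ^ 2 / (4 * (lam * Real.pi ^ 2)) = mu ^ 2 / (4 * lam) := by
    field_simp
  set f : ℕ → ℝ := fun n ↦ Real.exp (-lam * Real.pi ^ 2 * (n : ℝ) ^ 2 + mu * Real.pi * n) with hf
  have hle (n : ℕ) : f (n + 2) ≤ Real.exp (mu ^ 2 / (4 * lam)) *
      Real.exp (-lam * Real.pi ^ 2 * ((n : ℝ) + 1) ^ 2) := by
    have h := exp_neg_mul_add_two_sq_le hc (b := mu * Real.pi)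
      (by nlinarith [mul_le_mul_of_nonneg_right hmu hpi.le]) n.cast_nonneg
    rw [hquot] at h
    simpa [hf] using h
  have hs2 : Summable fun n ↦ f (n + 2) :=
    .of_nonneg_of_le (fun _ ↦ (Real.exp_pos _).le) hle (hg.mul_left _)
  have hs : Summable f := (summable_nat_add_iff 2).mp hs2
  have hs1 : Summable fun n ↦ f (n + 1) := (summable_nat_add_iff 1).mpr hs
  have hbound := hs2.tsum_le_tsum hle (hg.mul_left _)
  rw [tsum_mul_left] at hbound
  have hsum : HasSum (fun n : ℤ ↦
      Real.exp (-lam * Real.pi ^ 2 * (n : ℝ) ^ 2 + mu * Real.pi * |(n : ℝ)|))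
      (∑' n, f n + ∑' n, f (n + 1)) := by
    refine HasSum.of_nat_of_neg_add_one ?_ ?_
    · simpa [hf] using hs.hasSum
    · convert hs1.hasSum using 2 with n
      have hn : (0 : ℝ) ≤ (n : ℝ) + 1 := by positivity
      simp only [hf]
      push_cast
      rw [abs_neg, abs_of_nonneg hn, neg_sq]
  have h0 : f 0 = 1 := by simp [hf]
  have h1 : f 1 = Real.exp (-lam * Real.pi ^ 2 + mu * Real.pi) := by simp [hf]
  have e0 := hs.tsum_eq_zero_add
  have e1 := hs1.tsum_eq_zero_add
  simp only [zero_add, add_assoc, one_add_one_eq_two] at e1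
  rw [hsum.tsum_eq, e0, e1, h0, h1]
  linarith
end

section
/- Let M ≥ 1 be an integer, ã > 0, L = M·ã, and β > 0. For q : {+1,−1} × {+1,−1} × {1,…,M} → ℝ define H̃(q) = (v_F·π/L)·∑_{s ∈ {±1}} ∑_{x=1}^M [ (1+γ₁)·A·q(+1,s,x)² + (1−γ₁)·q(−1,s,x)² ] + (v_F·π·ã/L²)·∑_{s ∈ {±1}} [ (γ₂²/(1+γ₁))·(∑_{x=1}^M q(+1,s,x))² + γ₂·(∑_{x=1}^M q(+1,s,x))·(∑_{x=1}^M q(+1,−s,x)) ]. Then H̃ is a positive definite quadratic form on ℝ^{4M} and ∫_{ℝ^{4M}} exp(−β·H̃(q)) dq = √A · ( L/(β·ṽ_F·√A) )^{2M}. (This Gaussian determinant computation yields the zero-mode contribution to the free energy in Result 3.1.) -/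
open MeasureTheory

/-- The zero-mode quadratic form H̃ of the diagonalized Mattis Hamiltonian, acting on
real variables `q(r,s,x)`; the sign indices `r, s ∈ {+1, −1}` are encoded by `Bool`
(`true ↔ +1`, `false ↔ −1`, so `−s` is `!s`). -/
noncomputable def zeroModeForm (γ₁ γ₂ vF A aT L : ℝ) {M : ℕ}
    (q : Bool × Bool × Fin M → ℝ) : ℝ :=
  vF * Real.pi / L *
      ∑ s : Bool, ∑ x : Fin M,
        ((1 + γ₁) * A * q (true, s, x) ^ 2 + (1 - γ₁) * q (false, s, x) ^ 2) +
    vF * Real.pi * aT / L ^ 2 *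
      ∑ s : Bool,
        (γ₂ ^ 2 / (1 + γ₁) * (∑ x : Fin M, q (true, s, x)) ^ 2 +
          γ₂ * (∑ x : Fin M, q (true, s, x)) * ∑ x : Fin M, q (true, !s, x))

/-- Integral of a Gaussian of a diagonal quadratic form. -/
theorem integral_exp_neg_sum_mul_sq {ι : Type*} [Fintype ι] (c : ι → ℝ) :
    ∫ x : ι → ℝ, Real.exp (-∑ i, c i * x i ^ 2) = ∏ i, Real.sqrt (Real.pi / c i) := by
  simp_rw [← Finset.sum_neg_distrib, Real.exp_sum, ← neg_mul]
  rw [integral_fintype_prod_volume_eq_prod (fun i (t : ℝ) => Real.exp (-c i * t ^ 2))]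
  simp_rw [integral_gaussian]

/-- Linear change of variables for a continuous integrand. -/
theorem integral_comp_mulVec {ι : Type*} [Fintype ι] [DecidableEq ι] {T : Matrix ι ι ℝ}
    (hT : T.det ≠ 0) {f : (ι → ℝ) → ℝ} (hf : Continuous f) :
    ∫ x, f (T.mulVec x) = |T.det⁻¹| * ∫ x, f x := by
  have hcont : Continuous (Matrix.toLin' T) := LinearMap.continuous_of_finiteDimensional _
  have h := integral_map (μ := (volume : Measure (ι → ℝ))) (φ := Matrix.toLin' T) (f := f)
    hcont.aemeasurable hf.aestronglyMeasurable
  rw [Real.map_matrix_volume_pi_eq_smul_volume_pi hT, integral_smul_measure,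
    ENNReal.toReal_ofReal (abs_nonneg _), smul_eq_mul] at h
  simpa only [Matrix.toLin'_apply] using h.symm

/-- The matrix of the map adding `a * ∑ y, q (true, s, y) + b * ∑ y, q (true, !s, y)` to each
`q (true, s, x)` and fixing each `q (false, s, x)`. -/
def sectorShift (M : ℕ) (a b : ℝ) :
    Matrix (Bool × Bool × Fin M) (Bool × Bool × Fin M) ℝ :=
  1 + (Matrix.of fun i s => if i.1 then (if i.2.1 = s then a else b) else 0 :
      Matrix (Bool × Bool × Fin M) Bool ℝ) *
    (Matrix.of fun s j => if j.1 then (if j.2.1 = s then 1 else 0) else 0 :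
      Matrix Bool (Bool × Bool × Fin M) ℝ)

theorem det_sectorShift (M : ℕ) (a b : ℝ) :
    (sectorShift M a b).det = (1 + M * (a + b)) * (1 + M * (a - b)) := by
  rw [sectorShift, Matrix.det_one_add_mul_comm,
    ← Matrix.det_reindex_self finTwoEquiv.symm, Matrix.det_fin_two]
  simp [Matrix.mul_apply, Fintype.sum_prod_type, finTwoEquiv]
  ring

theorem sectorShift_mulVec_true (M : ℕ) (a b : ℝ) (q : Bool × Bool × Fin M → ℝ)
    (s : Bool) (x : Fin M) :
    (sectorShift M a b).mulVec q (true, s, x) =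
      q (true, s, x) + (a * ∑ y, q (true, s, y) + b * ∑ y, q (true, !s, y)) := by
  rw [sectorShift, Matrix.add_mulVec, ← Matrix.mulVec_mulVec]
  cases s <;> simp [-Matrix.mulVec_mulVec, Matrix.mulVec, dotProduct, Fintype.sum_prod_type]
  ring

theorem sectorShift_mulVec_false (M : ℕ) (a b : ℝ) (q : Bool × Bool × Fin M → ℝ)
    (s : Bool) (x : Fin M) :
    (sectorShift M a b).mulVec q (false, s, x) = q (false, s, x) := by
  rw [sectorShift, Matrix.add_mulVec, ← Matrix.mulVec_mulVec]
  simp [-Matrix.mulVec_mulVec, Matrix.mulVec, dotProduct]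

theorem sum_add_const_sq {ι : Type*} [Fintype ι] (f : ι → ℝ) (k : ℝ) :
    ∑ x, (f x + k) ^ 2 = ∑ x, f x ^ 2 + 2 * k * ∑ x, f x + Fintype.card ι * k ^ 2 := by
  simp_rw [add_sq, Finset.sum_add_distrib, ← Finset.sum_mul, ← Finset.mul_sum]
  simp
  ring

/-- Weights equal to `u` on the indices `(true, s, x)` and to `w` on the indices
`(false, s, x)`. -/
def sectorWeight (u w : ℝ) {M : ℕ} (i : Bool × Bool × Fin M) : ℝ := if i.1 then u else w

theorem sum_sectorWeight_mul_sq (u w : ℝ) {M : ℕ} (q : Bool × Bool × Fin M → ℝ) :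
    ∑ i, sectorWeight u w i * q i ^ 2 =
      ∑ s : Bool, ∑ x, (u * q (true, s, x) ^ 2 + w * q (false, s, x) ^ 2) := by
  simp [sectorWeight, Fintype.sum_prod_type, Finset.sum_add_distrib]
  ring

theorem sum_sectorWeight_mul_sectorShift_sq (u w a b : ℝ) {M : ℕ}
    (q : Bool × Bool × Fin M → ℝ) :
    ∑ i, sectorWeight u w i * (sectorShift M a b).mulVec q i ^ 2 =
      ∑ s : Bool, ∑ x, (u * q (true, s, x) ^ 2 + w * q (false, s, x) ^ 2) +
      ∑ s : Bool, (u * (2 * a + M * (a ^ 2 + b ^ 2)) * (∑ x, q (true, s, x)) ^ 2 +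
        u * (2 * b * (1 + M * a)) * (∑ x, q (true, s, x)) * ∑ x, q (true, !s, x)) := by
  rw [sum_sectorWeight_mul_sq]
  simp_rw [sectorShift_mulVec_true, sectorShift_mulVec_false, Finset.sum_add_distrib,
    ← Finset.mul_sum, sum_add_const_sq]
  simp
  ring

/-- Completing the square in the zero-mode form: it is diagonal after a `sectorShift` of
determinant `1 / √A`. -/
theorem exists_zeroModeForm_eq_sum_sq (γ₁ γ₂ vF A aT L : ℝ) (M : ℕ) (hM : 1 ≤ M)
    (hγ₂ : |γ₂| < 1 + γ₁) (hA : A = 1 - (γ₂ / (1 + γ₁)) ^ 2)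
    (haT : 0 < aT) (hL : L = M * aT) :
    ∃ T : Matrix (Bool × Bool × Fin M) (Bool × Bool × Fin M) ℝ,
      T.det = (Real.sqrt A)⁻¹ ∧ ∀ q, zeroModeForm γ₁ γ₂ vF A aT L q =
        ∑ i, sectorWeight (vF * Real.pi / L * ((1 + γ₁) * A)) (vF * Real.pi / L * (1 - γ₁)) i *
          T.mulVec q i ^ 2 := by
  have hp : 0 < 1 + γ₁ := (abs_nonneg _).trans_lt hγ₂
  have hM0 : (M : ℝ) ≠ 0 := by positivity
  obtain ⟨hlo, hhi⟩ := abs_lt.mp hγ₂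
  set g : ℝ := γ₂ / (1 + γ₁) with hg
  have hγg : γ₂ = (1 + γ₁) * g := by rw [hg]; field_simp
  have hg1 : 0 < 1 + g := by
    have : 0 < (1 + γ₁) * (1 + g) := by linarith
    exact pos_of_mul_pos_right this hp.le
  have hg2 : 0 < 1 - g := by
    have : 0 < (1 + γ₁) * (1 - g) := by linarith
    exact pos_of_mul_pos_right this hp.le
  have hAf : A = (1 + g) * (1 - g) := by rw [hA]; ring
  have hA0 : 0 < A := by rw [hAf]; positivity
  obtain ⟨σ, hσ⟩ : ∃ σ, σ = Real.sqrt ((1 + g) / A) := ⟨_, rfl⟩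
  obtain ⟨τ, hτ⟩ : ∃ τ, τ = Real.sqrt ((1 - g) / A) := ⟨_, rfl⟩
  have hσ2 : A * σ ^ 2 = 1 + g := by
    rw [hσ, Real.sq_sqrt (by positivity)]; field_simp
  have hτ2 : A * τ ^ 2 = 1 - g := by
    rw [hτ, Real.sq_sqrt (by positivity)]; field_simp
  refine ⟨sectorShift M (((σ + τ) / 2 - 1) / M) ((σ - τ) / 2 / M), ?_, fun q => ?_⟩
  · rw [det_sectorShift]
    have h : σ * τ = (Real.sqrt A)⁻¹ := by
      rw [hσ, hτ, ← Real.sqrt_mul (by positivity), ← Real.sqrt_inv]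
      congr 1
      rw [div_mul_div_comm, ← hAf]
      field_simp
    rw [← h]
    field_simp
    ring
  · have h₁ : (1 + γ₁) * A * (2 * (((σ + τ) / 2 - 1) / M) +
        M * ((((σ + τ) / 2 - 1) / M) ^ 2 + ((σ - τ) / 2 / M) ^ 2)) =
        γ₂ ^ 2 / (1 + γ₁) / M := by
      rw [hγg]
      field_simp
      linear_combination 2 * hσ2 + 2 * hτ2 - 4 * hA
    have h₂ : (1 + γ₁) * A * (2 * ((σ - τ) / 2 / M) * (1 + M * (((σ + τ) / 2 - 1) / M))) =
        γ₂ / M := by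
      rw [hγg]
      field_simp
      linear_combination hσ2 - hτ2
    have hc : vF * Real.pi * aT / L ^ 2 = vF * Real.pi / L * (1 / M) := by
      rw [hL]; field_simp
    rw [sum_sectorWeight_mul_sectorShift_sq, zeroModeForm, hc]
    simp_rw [mul_assoc (vF * Real.pi / L) ((1 + γ₁) * A), h₁, h₂, Finset.sum_add_distrib,
      ← Finset.mul_sum]
    simp only [Fintype.sum_bool, Bool.not_true, Bool.not_false]
    ring

theorem prod_sectorWeight (F : ℝ → ℝ) (u w : ℝ) (M : ℕ) :
    ∏ i : Bool × Bool × Fin M, F (sectorWeight u w i) = (F u * F w) ^ (2 * M) := by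
  simp [sectorWeight, Fintype.prod_prod_type]
  ring

theorem stmt_12 (γ₁ γ₂ vF A vF' aT L β : ℝ) (M : ℕ) (hM : 1 ≤ M)
    (hγ₁ : |γ₁| < 1) (hγ₂ : |γ₂| < 1 + γ₁) (hvF : 0 < vF)
    (hA : A = 1 - (γ₂ / (1 + γ₁)) ^ 2)
    (hvF' : vF' = vF * Real.sqrt (1 - γ₁ ^ 2))
    (haT : 0 < aT) (hL : L = M * aT) (hβ : 0 < β) :
    (∀ q : Bool × Bool × Fin M → ℝ, q ≠ 0 → 0 < zeroModeForm γ₁ γ₂ vF A aT L q) ∧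
    ∫ q : Bool × Bool × Fin M → ℝ, Real.exp (-β * zeroModeForm γ₁ γ₂ vF A aT L q) =
      Real.sqrt A * (L / (β * vF' * Real.sqrt A)) ^ (2 * M) := by
  have hp : 0 < 1 + γ₁ := (abs_nonneg _).trans_lt hγ₂
  have hm : 0 < 1 - γ₁ := by linarith [(abs_lt.mp hγ₁).2]
  have hA0 : 0 < A := by
    have : |γ₂ / (1 + γ₁)| < 1 := by rwa [abs_div, abs_of_pos hp, div_lt_one hp]
    rw [hA]
    linarith [(sq_lt_one_iff_abs_lt_one _).mpr this]
  have hL0 : 0 < L := by rw [hL]; positivity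
  obtain ⟨T, hdet, hT⟩ := exists_zeroModeForm_eq_sum_sq γ₁ γ₂ vF A aT L M hM hγ₂ hA haT hL
  have hdet0 : T.det ≠ 0 := by rw [hdet]; positivity
  obtain ⟨u, hu⟩ : ∃ u, u = vF * Real.pi / L * ((1 + γ₁) * A) := ⟨_, rfl⟩
  obtain ⟨w, hw⟩ : ∃ w, w = vF * Real.pi / L * (1 - γ₁) := ⟨_, rfl⟩
  have hu0 : 0 < u := by rw [hu]; positivity
  have hw0 : 0 < w := by rw [hw]; positivity
  have hpos : ∀ i : Bool × Bool × Fin M, 0 < sectorWeight u w i := by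
    intro i; rw [sectorWeight]; split_ifs <;> assumption
  simp_rw [← hu, ← hw] at hT
  constructor
  · intro q hq
    rw [hT]
    have hTq : T.mulVec q ≠ 0 := fun h => hq (Matrix.eq_zero_of_mulVec_eq_zero hdet0 h)
    obtain ⟨i, hi⟩ := Function.ne_iff.mp hTq
    refine Finset.sum_pos' (fun j _ => mul_nonneg (hpos j).le (sq_nonneg _))
      ⟨i, Finset.mem_univ i, mul_pos (hpos i) (sq_pos_of_ne_zero hi)⟩
  · have hexp : ∀ q, Real.exp (-β * zeroModeForm γ₁ γ₂ vF A aT L q) =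
        Real.exp (-∑ i, β * sectorWeight u w i * T.mulVec q i ^ 2) := by
      intro q
      rw [hT, neg_mul, Finset.mul_sum]
      simp_rw [mul_assoc]
    have hroot : Real.sqrt (Real.pi / (β * u)) * Real.sqrt (Real.pi / (β * w)) =
        L / (β * vF' * Real.sqrt A) := by
      rw [← Real.sqrt_mul (by positivity), Real.sqrt_eq_iff_mul_self_eq (by positivity)
        (by rw [hvF']; positivity), hvF', hu, hw]
      have h₁ : Real.sqrt (1 - γ₁ ^ 2) ^ 2 = (1 + γ₁) * (1 - γ₁) := by
        rw [Real.sq_sqrt] <;> nlinarith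
      have h₂ : Real.sqrt A ^ 2 = A := Real.sq_sqrt hA0.le
      rw [← sq, div_pow, mul_pow, mul_pow, mul_pow, h₁, h₂]
      field_simp
    simp_rw [hexp]
    rw [integral_comp_mulVec hdet0
        (f := fun y => Real.exp (-∑ i, β * sectorWeight u w i * y i ^ 2)) (by fun_prop),
      integral_exp_neg_sum_mul_sq,
      prod_sectorWeight (fun t => Real.sqrt (Real.pi / (β * t))), hroot, hdet, inv_inv,
      abs_of_nonneg (Real.sqrt_nonneg A)]
end

section
/- Let M ≥ 1 be an integer, ã > 0, L = M·ã, and β > 0, and let H̃ be the zero-mode quadratic form defined above. For ν : {+1,−1} × {+1,−1} × {1,…,M} → ℤ define q_ν(r,s,x) = (ν(+1,s,x) + r·ν(−1,s,x))/√2. Then the series Z_Q = ∑_{ν ∈ ℤ^{4M}} exp(−β·H̃(q_ν)) converges and satisfies Z_Q ≥ √A · ( L/(β·ṽ_F·√A) )^{2M}; that is, the zero-mode partition function of the Mattis model is bounded below by its Gaussian approximation. -/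
/-- The real configuration `q_ν(r,s,x) = (ν(+1,s,x) + r·ν(−1,s,x))/√2` associated with
integers `ν(r,s,x)`; `r = +1` is encoded by `true`, `r = −1` by `false`. -/
noncomputable def qOfNu {M : ℕ} (ν : Bool × Bool × Fin M → ℤ) :
    Bool × Bool × Fin M → ℝ :=
  fun rsx =>
    ((ν (true, rsx.2.1, rsx.2.2) : ℝ) +
        (if rsx.1 then (1 : ℝ) else -1) * (ν (false, rsx.2.1, rsx.2.2) : ℝ)) /
      Real.sqrt 2

section PositiveQuadraticTheta

open MeasureTheory Matrix
open scoped ENNReal Real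

variable {ι : Type*} [Fintype ι]

/-- An integral over `ℝ^ι` unfolds to the unit cube. -/
lemma lintegral_eq_tsum_unitCube (f : (ι → ℝ) → ℝ≥0∞) :
    ∫⁻ x, f x = ∑' ν : ι → ℤ,
      ∫⁻ x in Set.univ.pi fun _ : ι => Set.Ico (0 : ℝ) 1, f (fun i => x i + ν i) := by
  set C : Set (ι → ℝ) := Set.univ.pi fun _ : ι => Set.Ico (0 : ℝ) 1
  have hC : MeasurableSet C := MeasurableSet.univ_pi fun _ => measurableSet_Ico
  have hmem : ∀ (ν : ι → ℤ) (x : ι → ℝ),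
      x - (fun i => (ν i : ℝ)) ∈ C ↔ (fun i => ⌊x i⌋) = ν := by
    intro ν x
    simp only [C, Set.mem_univ_pi, Pi.sub_apply, Set.mem_Ico, funext_iff, Int.floor_eq_iff]
    exact forall_congr' fun i => by constructor <;> rintro ⟨h, h'⟩ <;> constructor <;> linarith
  set S : (ι → ℤ) → Set (ι → ℝ) := fun ν => (fun x => x - fun i => (ν i : ℝ)) ⁻¹' C
  have hS : ∀ ν, MeasurableSet (S ν) := fun ν => hC.preimage (measurable_id.sub_const _)
  have hdisj : Pairwise (Function.onFun Disjoint S) := by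
    intro ν μ hνμ
    refine Set.disjoint_left.2 fun x hx hx' => hνμ ?_
    rw [← (hmem ν x).1 hx, ← (hmem μ x).1 hx']
  have hU : ⋃ ν, S ν = Set.univ :=
    Set.eq_univ_of_forall fun x => Set.mem_iUnion.2 ⟨_, (hmem _ x).2 rfl⟩
  rw [← setLIntegral_univ, ← hU, lintegral_iUnion hS hdisj]
  refine tsum_congr fun ν => ?_
  have h := (measurePreserving_sub_right (volume : Measure (ι → ℝ))
    (fun i => (ν i : ℝ))).setLIntegral_comp_preimage_emb
    (MeasurableEquiv.subRight (fun i => (ν i : ℝ))).measurableEmbedding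
    (fun x => f (fun i => x i + ν i)) C
  rw [← h]
  simp [S]

/-- On a probability space the square of the mean is at most the mean of the square. -/
lemma sq_lintegral_le {α : Type*} [MeasurableSpace α] (μ : Measure α) [IsProbabilityMeasure μ]
    {f : α → ℝ≥0∞} (hf : AEMeasurable f μ) : (∫⁻ x, f x ∂μ) ^ 2 ≤ ∫⁻ x, f x ^ 2 ∂μ := by
  have h := ENNReal.lintegral_mul_le_Lp_mul_Lq μ Real.HolderConjugate.two_two hf
    (aemeasurable_const (b := (1 : ℝ≥0∞)))
  simp only [Pi.mul_apply, mul_one, lintegral_const, measure_univ, ENNReal.one_rpow,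
    ENNReal.rpow_two, one_pow] at h
  calc (∫⁻ x, f x ∂μ) ^ 2 ≤ ((∫⁻ x, f x ^ 2 ∂μ) ^ (1 / (2 : ℝ))) ^ 2 := by gcongr
    _ = ∫⁻ x, f x ^ 2 ∂μ := by
      rw [← ENNReal.rpow_two, ← ENNReal.rpow_mul]; norm_num

lemma measurable_sum_sq_mulVec (B : Matrix ι ι ℝ) :
    Measurable fun x : ι → ℝ => ∑ i, (B *ᵥ x) i ^ 2 := by
  simp only [mulVec, dotProduct]
  fun_prop

/-- The autocorrelation of the Gaussian `exp (-2 ‖B x‖²)`. -/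
lemma lintegral_autocorrelation_gaussian {B : Matrix ι ι ℝ} (ν : ι → ℝ) :
    ∫⁻ z : ι → ℝ, ENNReal.ofReal (Real.exp (-2 * ∑ i, (B *ᵥ z) i ^ 2)) *
        ENNReal.ofReal (Real.exp (-2 * ∑ i, (B *ᵥ fun j => z j + ν j) i ^ 2)) =
      ENNReal.ofReal (Real.exp (-∑ i, (B *ᵥ ν) i ^ 2)) *
        ∫⁻ z : ι → ℝ, ENNReal.ofReal (Real.exp (-4 * ∑ i, (B *ᵥ z) i ^ 2)) := by
  rw [← lintegral_add_right_eq_self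
      (fun z : ι → ℝ => ENNReal.ofReal (Real.exp (-4 * ∑ i, (B *ᵥ z) i ^ 2))) ((1 / 2 : ℝ) • ν),
    ← lintegral_const_mul' _ _ ENNReal.ofReal_ne_top]
  refine lintegral_congr fun z => ?_
  rw [← ENNReal.ofReal_mul (Real.exp_pos _).le, ← ENNReal.ofReal_mul (Real.exp_pos _).le,
    ← Real.exp_add, ← Real.exp_add]
  congr 2
  change _ + -2 * ∑ i, (B *ᵥ (z + ν)) i ^ 2 = _
  simp only [mulVec_add, mulVec_smul, Pi.add_apply, Pi.smul_apply, smul_eq_mul, Finset.mul_sum,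
    ← Finset.sum_neg_distrib, ← Finset.sum_add_distrib]
  exact Finset.sum_congr rfl fun i _ => by ring

/-- The Gaussian sum over `ℤ^ι` of a positive definite quadratic form `x ↦ ‖B x‖²`. -/
noncomputable def latticeGaussianSum (B : Matrix ι ι ℝ) : ℝ≥0∞ :=
  ∑' ν : ι → ℤ, ENNReal.ofReal (Real.exp (-∑ i, (B *ᵥ fun j => (ν j : ℝ)) i ^ 2))

variable [DecidableEq ι]

lemma lintegral_exp_neg_sum_sq_mulVec {B : Matrix ι ι ℝ} (hB : B.det ≠ 0) {c : ℝ} (hc : 0 < c) :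
    ∫⁻ x : ι → ℝ, ENNReal.ofReal (Real.exp (-c * ∑ i, (B *ᵥ x) i ^ 2)) =
      ENNReal.ofReal (√(π / c) ^ Fintype.card ι / |B.det|) := by
  have hprod : ∀ y : ι → ℝ,
      Real.exp (-c * ∑ i, y i ^ 2) = ∏ i, Real.exp (-c * y i ^ 2) := by
    intro y
    rw [Finset.mul_sum, Real.exp_sum]
  have hint : Integrable fun y : ι → ℝ => ∏ i, Real.exp (-c * y i ^ 2) :=
    Integrable.fintype_prod fun _ => integrable_exp_neg_mul_sq hc
  have hstd : ∫⁻ y : ι → ℝ, ENNReal.ofReal (Real.exp (-c * ∑ i, y i ^ 2)) =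
      ENNReal.ofReal (√(π / c) ^ Fintype.card ι) := by
    simp_rw [hprod]
    rw [← ofReal_integral_eq_lintegral_ofReal hint
      (Filter.Eventually.of_forall fun _ => Finset.prod_nonneg fun _ _ => (Real.exp_pos _).le),
      integral_fintype_prod_volume_eq_pow (fun x : ℝ => Real.exp (-c * x ^ 2)), integral_gaussian]
  have hmap := Real.map_matrix_volume_pi_eq_smul_volume_pi hB
  have hm : Measurable fun y : ι → ℝ => ENNReal.ofReal (Real.exp (-c * ∑ i, y i ^ 2)) := by
    fun_prop
  have hBm : Measurable (toLin' B) := (toLin' B).continuous_of_finiteDimensional.measurable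
  have h := lintegral_map (μ := volume) hm hBm
  rw [hmap, lintegral_smul_measure, hstd] at h
  simp only [toLin'_apply] at h
  rw [← h, smul_eq_mul, ← ENNReal.ofReal_mul (abs_nonneg _), abs_inv]
  congr 1
  field_simp

lemma latticeGaussianSum_ne_top {B : Matrix ι ι ℝ} (hB : B.det ≠ 0) :
    latticeGaussianSum B ≠ ∞ := by
  set C : Set (ι → ℝ) := Set.univ.pi fun _ : ι => Set.Ico (0 : ℝ) 1
  have hvol : volume C = 1 := by simp [C, Real.volume_pi_Ico]
  obtain ⟨K, hK⟩ : ∃ K, ∀ x ∈ C, ∑ i, (B *ᵥ x) i ^ 2 ≤ K := by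
    have hcomp : IsCompact (Set.univ.pi fun _ : ι => Set.Icc (0 : ℝ) 1) :=
      isCompact_univ_pi fun _ => isCompact_Icc
    have hcont : Continuous fun x : ι → ℝ => ∑ i, (B *ᵥ x) i ^ 2 := by
      simp only [mulVec, dotProduct]; fun_prop
    obtain ⟨K, hK⟩ := hcomp.bddAbove_image hcont.continuousOn
    exact ⟨K, fun x hx => hK ⟨x, Set.pi_mono (fun _ _ => Set.Ico_subset_Icc_self) hx, rfl⟩⟩
  have hle : latticeGaussianSum B ≤ ENNReal.ofReal (Real.exp K) *
      ∫⁻ x : ι → ℝ, ENNReal.ofReal (Real.exp (-(1 / 2) * ∑ i, (B *ᵥ x) i ^ 2)) := by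
    rw [lintegral_eq_tsum_unitCube, ← ENNReal.tsum_mul_left]
    refine ENNReal.tsum_le_tsum fun ν => ?_
    rw [← lintegral_const_mul' _ _ ENNReal.ofReal_ne_top]
    calc ENNReal.ofReal (Real.exp (-∑ i, (B *ᵥ fun j => (ν j : ℝ)) i ^ 2))
        = ∫⁻ _ in C, ENNReal.ofReal (Real.exp (-∑ i, (B *ᵥ fun j => (ν j : ℝ)) i ^ 2)) := by
          simp [hvol]
      _ ≤ _ := by
          refine setLIntegral_mono' (MeasurableSet.univ_pi fun _ => measurableSet_Ico)
            fun x hx => ?_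
          rw [← ENNReal.ofReal_mul (Real.exp_pos _).le, ← Real.exp_add]
          refine ENNReal.ofReal_le_ofReal (Real.exp_le_exp.2 ?_)
          have hsum : ∑ i, (B *ᵥ fun j => x j + (ν j : ℝ)) i ^ 2 ≤
              2 * ∑ i, (B *ᵥ x) i ^ 2 + 2 * ∑ i, (B *ᵥ fun j => (ν j : ℝ)) i ^ 2 := by
            rw [Finset.mul_sum, Finset.mul_sum, ← Finset.sum_add_distrib]
            refine Finset.sum_le_sum fun i _ => ?_
            change (B *ᵥ (x + fun j => (ν j : ℝ))) i ^ 2 ≤ _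
            rw [mulVec_add, Pi.add_apply]
            nlinarith [sq_nonneg ((B *ᵥ x) i - (B *ᵥ fun j => (ν j : ℝ)) i)]
          linarith [hK x hx]
  refine ne_top_of_le_ne_top ?_ hle
  rw [lintegral_exp_neg_sum_sq_mulVec hB (by norm_num)]
  exact ENNReal.mul_ne_top ENNReal.ofReal_ne_top ENNReal.ofReal_ne_top

lemma integral_le_latticeGaussianSum {B : Matrix ι ι ℝ} (hB : B.det ≠ 0) :
    ENNReal.ofReal (√π ^ Fintype.card ι / |B.det|) ≤ latticeGaussianSum B := by
  set C : Set (ι → ℝ) := Set.univ.pi fun _ : ι => Set.Ico (0 : ℝ) 1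
  have : IsProbabilityMeasure ((volume : Measure (ι → ℝ)).restrict C) :=
    ⟨by simp [C, Real.volume_pi_Ico]⟩
  set g : (ι → ℝ) → ℝ≥0∞ := fun z => ENNReal.ofReal (Real.exp (-2 * ∑ i, (B *ᵥ z) i ^ 2))
  have hg : Measurable g :=
    ((measurable_sum_sq_mulVec B).const_mul _).exp.ennreal_ofReal
  set G : (ι → ℝ) → ℝ≥0∞ := fun z => ∑' ν : ι → ℤ, g (fun i => z i + ν i)
  have hgν : ∀ ν : ι → ℤ, Measurable fun z : ι → ℝ => g (fun i => z i + ν i) :=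
    fun ν => hg.comp (by fun_prop)
  have hG : Measurable G := Measurable.tsum hgν
  have hmean : ∫⁻ z, g z = ∫⁻ z in C, G z := by
    rw [lintegral_eq_tsum_unitCube, lintegral_tsum fun ν => (hgν ν).aemeasurable]
  have hsq : latticeGaussianSum B *
      ∫⁻ z : ι → ℝ, ENNReal.ofReal (Real.exp (-4 * ∑ i, (B *ᵥ z) i ^ 2)) =
        ∫⁻ z in C, G z ^ 2 := by
    have hshift : ∀ (μ : ι → ℤ) (z : ι → ℝ),
        ∑' ν : ι → ℤ, g (fun i => z i + μ i + ν i) = G z := by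
      intro μ z
      refine Eq.trans ?_ ((Equiv.addLeft μ).tsum_eq fun ν : ι → ℤ => g (fun i => z i + ν i))
      refine tsum_congr fun ν => congrArg g (funext fun i => ?_)
      simp [add_assoc]
    have hgm : ∀ μ ν : ι → ℤ, Measurable fun z : ι → ℝ => g (fun i => z i + μ i + ν i) :=
      fun μ ν => hg.comp (by fun_prop)
    calc _ = ∑' ν : ι → ℤ, ∫⁻ z, g z * g (fun i => z i + ν i) := by
          rw [latticeGaussianSum, ← ENNReal.tsum_mul_right]
          exact tsum_congr fun ν => (lintegral_autocorrelation_gaussian _).symm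
      _ = ∑' (ν : ι → ℤ) (μ : ι → ℤ), ∫⁻ z in C,
            g (fun i => z i + μ i) * g (fun i => z i + μ i + ν i) :=
          tsum_congr fun ν => lintegral_eq_tsum_unitCube _
      _ = ∑' (μ : ι → ℤ) (ν : ι → ℤ), ∫⁻ z in C,
            g (fun i => z i + μ i) * g (fun i => z i + μ i + ν i) := ENNReal.tsum_comm
      _ = ∑' μ : ι → ℤ, ∫⁻ z in C, g (fun i => z i + μ i) * G z := by
          refine tsum_congr fun μ => ?_
          refine (lintegral_tsum fun ν => ((hgν μ).mul (hgm μ ν)).aemeasurable).symm.trans ?_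
          simp_rw [Pi.mul_apply, ENNReal.tsum_mul_left, hshift]
      _ = ∫⁻ z in C, G z ^ 2 := by
          refine (lintegral_tsum fun μ => ((hgν μ).mul hG).aemeasurable).symm.trans ?_
          simp_rw [Pi.mul_apply, ENNReal.tsum_mul_right, sq]
          rfl
  have hCS := sq_lintegral_le (volume.restrict C) hG.aemeasurable
  rw [← hmean, ← hsq, lintegral_exp_neg_sum_sq_mulVec hB two_pos,
    lintegral_exp_neg_sum_sq_mulVec hB four_pos] at hCS
  have hd : 0 < |B.det| := abs_pos.2 hB
  have hJ : 0 < √(π / 4) ^ Fintype.card ι / |B.det| := by positivity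
  rw [← ENNReal.mul_le_mul_iff_left (ENNReal.ofReal_pos.2 hJ).ne' ENNReal.ofReal_ne_top]
  refine le_trans (le_of_eq ?_) hCS
  rw [← ENNReal.ofReal_mul (by positivity), ← ENNReal.ofReal_pow (by positivity)]
  congr 1
  rw [div_mul_div_comm, ← mul_pow, ← Real.sqrt_mul Real.pi_pos.le, div_pow, ← pow_mul, mul_comm _ 2,
    pow_mul, Real.sq_sqrt (by positivity), ← sq, show π * (π / 4) = (π / 2) ^ 2 by ring,
    Real.sqrt_sq (by positivity)]

/-- A Gaussian lattice sum dominates the corresponding Gaussian integral. -/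
theorem gaussian_integral_le_lattice_sum {B : Matrix ι ι ℝ} (hB : B.det ≠ 0) :
    (Summable fun ν : ι → ℤ => Real.exp (-∑ i, (B *ᵥ fun j => (ν j : ℝ)) i ^ 2)) ∧
      √π ^ Fintype.card ι / |B.det| ≤
        ∑' ν : ι → ℤ, Real.exp (-∑ i, (B *ᵥ fun j => (ν j : ℝ)) i ^ 2) := by
  have hs : Summable fun ν : ι → ℤ => Real.exp (-∑ i, (B *ᵥ fun j => (ν j : ℝ)) i ^ 2) := by
    have h := ENNReal.summable_toReal (latticeGaussianSum_ne_top hB)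
    simpa only [ENNReal.toReal_ofReal (Real.exp_pos _).le] using h
  refine ⟨hs, ?_⟩
  have h := integral_le_latticeGaussianSum hB
  rw [latticeGaussianSum, ← ENNReal.ofReal_tsum_of_nonneg (fun _ => (Real.exp_pos _).le) hs] at h
  exact (ENNReal.ofReal_le_ofReal_iff (tsum_nonneg fun _ => (Real.exp_pos _).le)).1 h

end PositiveQuadraticTheta

section MattisDiagonalization

open Matrix
open scoped Real Kronecker

/-- The `2 × 2` Hadamard rotation to even and odd combinations (`true` is even). -/
noncomputable def evenOddRotation : Matrix Bool Bool ℝ :=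
  Matrix.of fun r s => (if r || s then 1 else -1) / √2

lemma evenOddRotation_det_sq : evenOddRotation.det ^ 2 = 1 := by
  have h : evenOddRotation * evenOddRotation = 1 := by
    ext r s
    have h2 : √2 ^ 2 = (2 : ℝ) := Real.sq_sqrt two_pos.le
    cases r <;> cases s <;>
      simp [evenOddRotation, Matrix.mul_apply] <;> field_simp <;> norm_num
  rw [sq, ← det_mul, h, det_one]

variable {M : ℕ}

/-- The rotation of the integer labels `ν(r,s,x)` in both sign indices. -/
noncomputable def labelRotation (M : ℕ) : Matrix (Bool × Bool × Fin M) (Bool × Bool × Fin M) ℝ :=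
  evenOddRotation ⊗ₖ (evenOddRotation ⊗ₖ (1 : Matrix (Fin M) (Fin M) ℝ))

lemma abs_labelRotation_det (M : ℕ) : |(labelRotation M).det| = 1 := by
  have h : |evenOddRotation.det| = 1 := by
    rw [← Real.sqrt_sq_eq_abs, evenOddRotation_det_sq, Real.sqrt_one]
  simp [labelRotation, det_kronecker, abs_mul, abs_pow, h]

lemma labelRotation_mulVec (v : Bool × Bool × Fin M → ℝ) (r s : Bool) (x : Fin M) :
    (labelRotation M *ᵥ v) (r, s, x) = ∑ r', evenOddRotation r r' *
      ∑ s', evenOddRotation s s' * v (r', s', x) := by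
  simp only [labelRotation, mulVec, dotProduct, Fintype.sum_prod_type, kroneckerMap_apply,
    Matrix.one_apply, mul_ite, mul_one, mul_zero, ite_mul, zero_mul, Finset.sum_ite_eq,
    Finset.mem_univ, if_true, Finset.mul_sum, mul_assoc]

/-- The matrix that scales block `k` by `d k` and its mean by a further factor `t k`. -/
noncomputable def blockMeanScaling {κ : Type*} [DecidableEq κ] (M : ℕ) (d t : κ → ℝ) :
    Matrix (κ × Fin M) (κ × Fin M) ℝ :=
  Matrix.of fun i j => if i.1 = j.1 then
    d i.1 * ((if i.2 = j.2 then 1 else 0) + (t i.1 - 1) / M) else 0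

lemma blockMeanScaling_mulVec {κ : Type*} [DecidableEq κ] [Fintype κ] (d t : κ → ℝ)
    (v : κ × Fin M → ℝ) (k : κ) (x : Fin M) :
    (blockMeanScaling M d t *ᵥ v) (k, x) =
      d k * (v (k, x) + (t k - 1) / M * ∑ y, v (k, y)) := by
  simp only [blockMeanScaling, mulVec, dotProduct, of_apply, Fintype.sum_prod_type, ite_mul,
    zero_mul, Finset.sum_ite_irrel, Finset.sum_const_zero, Finset.sum_ite_eq, Finset.mem_univ,
    if_true, mul_add, add_mul, Finset.sum_add_distrib, Finset.mul_sum, mul_ite, mul_one, mul_zero,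
    mul_assoc]

lemma blockMeanScaling_det {κ : Type*} [DecidableEq κ] [Fintype κ] (hM : 1 ≤ M) (d t : κ → ℝ) :
    (blockMeanScaling M d t).det = (∏ k, d k ^ M) * ∏ k, t k := by
  have hM' : (M : ℝ) ≠ 0 := by positivity
  set U : Matrix (κ × Fin M) κ ℝ := Matrix.of fun i k => if i.1 = k then (t k - 1) / M else 0
  set V : Matrix κ (κ × Fin M) ℝ := Matrix.of fun k i => if k = i.1 then 1 else 0
  have hfac : blockMeanScaling M d t = diagonal (fun i => d i.1) * (1 + U * V) := by
    ext ⟨k, x⟩ ⟨l, y⟩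
    rw [diagonal_mul]
    by_cases hkl : k = l
    · subst hkl
      simp [blockMeanScaling, U, V, Matrix.mul_apply, Matrix.one_apply]
    · simp [blockMeanScaling, U, V, Matrix.mul_apply, hkl]
  have hVU : 1 + V * U = diagonal t := by
    ext k l
    by_cases hkl : k = l
    · subst hkl
      simp [U, V, Matrix.mul_apply, Fintype.sum_prod_type, mul_div_cancel₀, hM']
    · simp [U, V, Matrix.mul_apply, Fintype.sum_prod_type, hkl]
  rw [hfac, det_mul, det_one_add_mul_comm, hVU, det_diagonal, det_diagonal, Fintype.prod_prod_type]
  simp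

/-- Scaling the mean of one block adds a multiple of the squared sum to the squared norm. -/
lemma sum_sq_blockMeanScaling {κ : Type*} [DecidableEq κ] [Fintype κ] (hM : 1 ≤ M) (d t : κ → ℝ)
    (v : κ × Fin M → ℝ) :
    ∑ i, (blockMeanScaling M d t *ᵥ v) i ^ 2 =
      ∑ k, d k ^ 2 * (∑ x, v (k, x) ^ 2 + (t k ^ 2 - 1) / M * (∑ x, v (k, x)) ^ 2) := by
  have hM' : (M : ℝ) ≠ 0 := by positivity
  rw [Fintype.sum_prod_type]
  refine Finset.sum_congr rfl fun k _ => ?_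
  simp_rw [blockMeanScaling_mulVec, mul_pow, ← Finset.mul_sum, add_sq, Finset.sum_add_distrib,
    ← Finset.sum_mul, ← Finset.mul_sum]
  simp only [Finset.sum_const, Finset.card_univ, Fintype.card_fin, nsmul_eq_mul]
  field_simp
  ring

lemma labelRotation_mulVec_eq_qOfNu (ν : Bool × Bool × Fin M → ℤ) (r s : Bool) (x : Fin M) :
    (labelRotation M *ᵥ fun j => (ν j : ℝ)) (r, s, x) =
      ∑ s', evenOddRotation s s' * qOfNu ν (r, s', x) := by
  rw [labelRotation_mulVec]
  cases r <;> cases s <;> simp [evenOddRotation, qOfNu] <;> ring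

/-- The square root of the zero-mode form: block `(r, s)` is scaled by `d r`, and the means of the
blocks `(true, s)` by further factors `t s`. -/
noncomputable def zeroModeRoot (M : ℕ) (d t : Bool → ℝ) :
    Matrix (Bool × Bool × Fin M) (Bool × Bool × Fin M) ℝ :=
  (blockMeanScaling M (fun k : Bool × Bool => d k.1) (fun k => if k.1 then t k.2 else 1)).submatrix
    (Equiv.prodAssoc Bool Bool (Fin M)).symm (Equiv.prodAssoc Bool Bool (Fin M)).symm *
      labelRotation M

lemma abs_zeroModeRoot_det (hM : 1 ≤ M) (d t : Bool → ℝ) :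
    |(zeroModeRoot M d t).det| = |(d true * d false) ^ (2 * M) * (t true * t false)| := by
  rw [zeroModeRoot, det_mul, det_submatrix_equiv_self, abs_mul, abs_labelRotation_det, mul_one,
    blockMeanScaling_det hM]
  congr 1
  simp only [Fintype.prod_prod_type, Fintype.prod_bool, if_true, Bool.false_eq_true, if_false]
  ring

lemma sum_sq_zeroModeRoot (hM : 1 ≤ M) (d t : Bool → ℝ) (ν : Bool × Bool × Fin M → ℤ) :
    ∑ i, (zeroModeRoot M d t *ᵥ fun j => (ν j : ℝ)) i ^ 2 =
      ∑ s : Bool, ∑ x : Fin M,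
        (d true ^ 2 * qOfNu ν (true, s, x) ^ 2 + d false ^ 2 * qOfNu ν (false, s, x) ^ 2) +
      d true ^ 2 / M * ∑ s : Bool,
        (((t true ^ 2 + t false ^ 2) / 2 - 1) * (∑ x, qOfNu ν (true, s, x)) ^ 2 +
          (t true ^ 2 - t false ^ 2) / 2 * (∑ x, qOfNu ν (true, s, x)) *
            ∑ x, qOfNu ν (true, !s, x)) := by
  have hM' : (M : ℝ) ≠ 0 := by positivity
  have h2 : √2 ^ 2 = (2 : ℝ) := Real.sq_sqrt two_pos.le
  have h2' : (√2)⁻¹ ^ 2 = (2 : ℝ)⁻¹ := by rw [inv_pow, h2]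
  rw [zeroModeRoot, ← mulVec_mulVec, submatrix_mulVec_equiv]
  simp only [Function.comp_apply]
  rw [(Equiv.prodAssoc Bool Bool (Fin M)).symm.sum_comp fun i => (blockMeanScaling M
      (fun k : Bool × Bool => d k.1) (fun k => if k.1 then t k.2 else 1) *ᵥ
        ((labelRotation M *ᵥ fun j => (ν j : ℝ)) ∘
          (Equiv.prodAssoc Bool Bool (Fin M)).symm.symm)) i ^ 2, sum_sq_blockMeanScaling hM]
  simp only [Function.comp_apply, Equiv.symm_symm, Equiv.prodAssoc_apply,
    labelRotation_mulVec_eq_qOfNu, Fintype.sum_prod_type, Fintype.sum_bool, evenOddRotation,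
    of_apply, Bool.or_true, Bool.or_false, if_true, Bool.not_true, Bool.not_false,
    Bool.false_eq_true, if_false, add_sq, mul_pow, Finset.sum_add_distrib, ← Finset.mul_sum,
    div_pow, h2]
  have hX : ∀ (r : Bool) (a b : ℝ), ∑ x, 2 * (a * qOfNu ν (r, true, x)) *
      (b * qOfNu ν (r, false, x)) =
        2 * a * b * ∑ x, qOfNu ν (r, true, x) * qOfNu ν (r, false, x) := by
    intro r a b
    rw [Finset.mul_sum]
    exact Finset.sum_congr rfl fun x _ => by ring
  simp only [hX]
  ring_nf
  simp only [h2']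
  ring

/-- The zero-mode form as a squared norm. -/
lemma mul_zeroModeForm_eq_sum_sq {γ₁ γ₂ vF A aT L β : ℝ} (hM : 1 ≤ M) (hL : L = M * aT)
    (haT : 0 < aT) {d t : Bool → ℝ}
    (hd : d true ^ 2 = β * (vF * π / L) * ((1 + γ₁) * A))
    (hd' : d false ^ 2 = β * (vF * π / L) * (1 - γ₁))
    (ht : (1 + γ₁) * A * t true ^ 2 = 1 + γ₁ + γ₂) (ht' : (1 + γ₁) * A * t false ^ 2 = 1 + γ₁ - γ₂)
    (hγ₁ : 1 + γ₁ ≠ 0) (hA : A = 1 - (γ₂ / (1 + γ₁)) ^ 2) (ν : Bool × Bool × Fin M → ℤ) :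
    β * zeroModeForm γ₁ γ₂ vF A aT L (qOfNu ν) =
      ∑ i, (zeroModeRoot M d t *ᵥ fun j => (ν j : ℝ)) i ^ 2 := by
  have hM' : (M : ℝ) ≠ 0 := by positivity
  have hmean : (1 + γ₁) * A * ((t true ^ 2 + t false ^ 2) / 2 - 1) = γ₂ ^ 2 / (1 + γ₁) := by
    have : (1 + γ₁) * A = 1 + γ₁ - γ₂ ^ 2 / (1 + γ₁) := by rw [hA]; field_simp
    linear_combination ht / 2 + ht' / 2 - this
  have hdiff : (1 + γ₁) * A * ((t true ^ 2 - t false ^ 2) / 2) = γ₂ := by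
    linear_combination ht / 2 - ht' / 2
  have hscale : vF * π * aT / L ^ 2 = vF * π / L / M := by
    rw [hL]; field_simp
  rw [sum_sq_zeroModeRoot hM, zeroModeForm, hd, hd', hscale, mul_add]
  congr 1
  · simp only [Finset.mul_sum]
    exact Finset.sum_congr rfl fun s _ => Finset.sum_congr rfl fun x _ => by ring
  · rw [← hmean]
    nth_rewrite 1 [← hdiff]
    simp only [Finset.mul_sum (Finset.univ : Finset Bool)]
    exact Finset.sum_congr rfl fun s _ => by ring

end MattisDiagonalization

theorem stmt_13 (γ₁ γ₂ vF A vF' aT L β : ℝ) (M : ℕ) (hM : 1 ≤ M)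
    (hγ₁ : |γ₁| < 1) (hγ₂ : |γ₂| < 1 + γ₁) (hvF : 0 < vF)
    (hA : A = 1 - (γ₂ / (1 + γ₁)) ^ 2)
    (hvF' : vF' = vF * Real.sqrt (1 - γ₁ ^ 2))
    (haT : 0 < aT) (hL : L = M * aT) (hβ : 0 < β) :
    Summable (fun ν : Bool × Bool × Fin M → ℤ =>
      Real.exp (-β * zeroModeForm γ₁ γ₂ vF A aT L (qOfNu ν))) ∧
    Real.sqrt A * (L / (β * vF' * Real.sqrt A)) ^ (2 * M) ≤
      ∑' ν : Bool × Bool × Fin M → ℤ,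
        Real.exp (-β * zeroModeForm γ₁ γ₂ vF A aT L (qOfNu ν)) := by
  have hγ := abs_lt.1 hγ₁
  have hγ' := abs_lt.1 hγ₂
  have h1 : 0 < 1 + γ₁ := by linarith
  have h1' : 0 < 1 - γ₁ := by linarith
  have hApos : 0 < A := by
    have h : |γ₂ / (1 + γ₁)| < 1 := by rwa [abs_div, abs_of_pos h1, div_lt_one h1]
    rw [hA]
    linarith [(sq_lt_one_iff_abs_lt_one _).2 h]
  have hMpos : (0 : ℝ) < M := Nat.cast_pos.2 hM
  have hLpos : 0 < L := hL ▸ mul_pos hMpos haT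
  have hα : 0 < (1 + γ₁) * A := mul_pos h1 hApos
  have hκ : 0 < β * (vF * Real.pi / L) := by positivity
  set d : Bool → ℝ := fun r =>
    √(β * (vF * Real.pi / L) * if r then (1 + γ₁) * A else 1 - γ₁) with hd
  set t : Bool → ℝ := fun s => √((1 + γ₁ + if s then γ₂ else -γ₂) / ((1 + γ₁) * A)) with ht
  have hd1 : d true ^ 2 = β * (vF * Real.pi / L) * ((1 + γ₁) * A) := by
    simp only [hd, if_true]
    exact Real.sq_sqrt (by positivity)
  have hd2 : d false ^ 2 = β * (vF * Real.pi / L) * (1 - γ₁) := by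
    simp only [hd, Bool.false_eq_true, if_false]
    exact Real.sq_sqrt (by positivity)
  have hpos1 : 0 < (1 + γ₁ + γ₂) / ((1 + γ₁) * A) := div_pos (by linarith) hα
  have hpos2 : 0 < (1 + γ₁ + -γ₂) / ((1 + γ₁) * A) := div_pos (by linarith) hα
  have ht1 : (1 + γ₁) * A * t true ^ 2 = 1 + γ₁ + γ₂ := by
    simp only [ht, if_true]
    rw [Real.sq_sqrt hpos1.le, mul_div_cancel₀ _ hα.ne']
  have ht2 : (1 + γ₁) * A * t false ^ 2 = 1 + γ₁ - γ₂ := by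
    simp only [ht, Bool.false_eq_true, if_false]
    rw [Real.sq_sqrt hpos2.le, mul_div_cancel₀ _ hα.ne', sub_eq_add_neg]
  have htt : t true * t false = 1 / √A := by
    simp only [ht, if_true, Bool.false_eq_true, if_false]
    rw [← Real.sqrt_mul hpos1.le, one_div, ← Real.sqrt_inv]
    congr 1
    have hA' : A * (1 + γ₁) ^ 2 = (1 + γ₁) ^ 2 - γ₂ ^ 2 := by
      rw [hA]
      field_simp
    rw [div_mul_div_comm, inv_eq_one_div, div_eq_div_iff (mul_pos hα hα).ne' hApos.ne']
    linear_combination -A * hA'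
  have hdd : d true * d false = β * (vF * Real.pi / L) * (√(1 - γ₁ ^ 2) * √A) := by
    have h : 0 ≤ 1 - γ₁ ^ 2 := by nlinarith
    simp only [hd, if_true, Bool.false_eq_true, if_false]
    rw [← Real.sqrt_mul (by positivity), ← Real.sqrt_mul h]
    conv_rhs => rw [← Real.sqrt_sq hκ.le, ← Real.sqrt_mul (sq_nonneg _)]
    congr 1
    ring
  have hγsq : 0 < √(1 - γ₁ ^ 2) := Real.sqrt_pos.2 (by nlinarith)
  have hsA : 0 < √A := Real.sqrt_pos.2 hApos
  have hdet : |(zeroModeRoot M d t).det| =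
      (β * (vF * Real.pi / L) * (√(1 - γ₁ ^ 2) * √A)) ^ (2 * M) * (1 / √A) := by
    rw [abs_zeroModeRoot_det hM, hdd, htt, abs_of_pos (by positivity)]
  have hne : (zeroModeRoot M d t).det ≠ 0 := by
    rw [← abs_pos, hdet]
    positivity
  have hval : √Real.pi ^ Fintype.card (Bool × Bool × Fin M) / |(zeroModeRoot M d t).det| =
      √A * (L / (β * vF' * √A)) ^ (2 * M) := by
    have hcard : Fintype.card (Bool × Bool × Fin M) = 2 * (2 * M) := by
      simp
    rw [hdet, hcard, pow_mul, Real.sq_sqrt Real.pi_pos.le, hvF', ← div_div, ← div_pow,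
      div_div_eq_mul_div, div_one, mul_comm]
    congr 2
    have := Real.pi_pos
    field_simp
  have h := gaussian_integral_le_lattice_sum hne
  simp_rw [← mul_zeroModeForm_eq_sum_sq hM hL haT hd1 hd2 ht1 ht2 h1.ne' hA, hval, ← neg_mul] at h
  exact h
end

section
/- Define E₁(x) = ∫₁^∞ t⁻¹·e^{−x·t} dt for x > 0, and σ(x) = exp(−E₁(x)). Then E₁(x) + log x tends to −γ as x → 0⁺, where γ is the Euler–Mascheroni constant; equivalently, σ(x)/x tends to e^γ as x → 0⁺. (This is the small-argument asymptotic σ(z) = e^γ·z·(1+O(z)) used for the fermion two-point function, Result 4.2.) -/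
/-- The exponential integral `E₁(x) = ∫₁^∞ t⁻¹ e^{−xt} dt`. -/
noncomputable def expIntE1 (x : ℝ) : ℝ :=
  ∫ t in Set.Ioi (1 : ℝ), t⁻¹ * Real.exp (-x * t)

open Filter MeasureTheory Set Topology

theorem integral_log_mul_exp_neg_Ioi :
    ∫ t in Ioi (0 : ℝ), Real.log t * Real.exp (-t) = -Real.eulerMascheroniConstant := by
  have h := Complex.hasDerivAt_GammaIntegral (s := 1) (by simp)
  have hΓ : HasDerivAt Complex.GammaIntegral (-Real.eulerMascheroniConstant : ℂ) 1 := by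
    refine Complex.hasDerivAt_Gamma_one.congr_of_eventuallyEq ?_
    have : IsOpen {s : ℂ | 0 < s.re} := isOpen_lt continuous_const Complex.continuous_re
    filter_upwards [this.mem_nhds (show (1 : ℂ) ∈ {s : ℂ | 0 < s.re} by simp)] with s hs
    exact (Complex.Gamma_eq_integral hs).symm
  have key := h.unique hΓ
  simp only [sub_self, Complex.cpow_zero, one_mul] at key
  simp only [← Complex.ofReal_mul, integral_complex_ofReal] at key
  exact_mod_cast key

theorem integrableOn_log_mul_exp_neg_Ioi :
    IntegrableOn (fun t : ℝ => Real.log t * Real.exp (-t)) (Ioi 0) := by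
  refine not_imp_comm.1 integral_undef ?_
  rw [integral_log_mul_exp_neg_Ioi]
  linarith [Real.one_half_lt_eulerMascheroniConstant]

theorem integrableOn_inv_mul_exp_neg_Ioi {x : ℝ} (hx : 0 < x) :
    IntegrableOn (fun t : ℝ => t⁻¹ * Real.exp (-t)) (Ioi x) := by
  refine ((integrableOn_exp_neg_Ioi x).const_mul x⁻¹).mono'
    (by fun_prop) ((ae_restrict_mem measurableSet_Ioi).mono fun t ht => ?_)
  have ht0 : 0 < t := hx.trans ht
  rw [Real.norm_of_nonneg (by positivity)]
  gcongr
  exact (mem_Ioi.1 ht).le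

theorem expIntE1_eq_integral_Ioi {x : ℝ} (hx : 0 < x) :
    expIntE1 x = ∫ t in Ioi x, t⁻¹ * Real.exp (-t) := by
  have h := integral_comp_mul_left_Ioi' (fun t : ℝ => t⁻¹ * Real.exp (-t)) 1 hx
  rw [mul_one] at h
  rw [← h, smul_eq_mul, ← integral_const_mul, expIntE1]
  refine integral_congr_ae (.of_forall fun t => ?_)
  simp only [mul_inv, neg_mul]
  field_simp

theorem tendsto_log_mul_exp_neg_atTop :
    Tendsto (fun t : ℝ => Real.log t * Real.exp (-t)) atTop (𝓝 0) := by
  have h : Tendsto (fun t : ℝ => t * Real.exp (-t)) atTop (𝓝 0) := by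
    simpa using Real.tendsto_pow_mul_exp_neg_atTop_nhds_zero 1
  refine squeeze_zero' ?_ ?_ h
  · filter_upwards [eventually_ge_atTop 1] with t ht
    exact mul_nonneg (Real.log_nonneg ht) (Real.exp_pos _).le
  · filter_upwards [eventually_ge_atTop 1] with t ht
    gcongr
    exact Real.log_le_self (by linarith)

theorem expIntE1_eq_neg_log_mul_exp_add {x : ℝ} (hx : 0 < x) :
    expIntE1 x = -(Real.log x * Real.exp (-x)) +
      ∫ t in Ioi x, Real.log t * Real.exp (-t) := by
  have hlog := integrableOn_log_mul_exp_neg_Ioi.mono_set (Ioi_subset_Ioi hx.le)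
  have hinv := integrableOn_inv_mul_exp_neg_Ioi hx
  have h := integral_Ioi_of_hasDerivAt_of_tendsto' (a := x)
    (f' := fun t => t⁻¹ * Real.exp (-t) - Real.log t * Real.exp (-t)) (fun t ht => ?_)
    (hinv.sub hlog) tendsto_log_mul_exp_neg_atTop
  · rw [integral_sub hinv hlog, ← expIntE1_eq_integral_Ioi hx] at h
    linarith
  · have ht0 : t ≠ 0 := (hx.trans_le ht).ne'
    convert! (Real.hasDerivAt_log ht0).mul (hasDerivAt_neg t).exp using 1
    ring

theorem tendsto_one_sub_exp_neg_mul_log_nhdsGT_zero :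
    Tendsto (fun x : ℝ => (1 - Real.exp (-x)) * Real.log x) (𝓝[>] 0) (𝓝 0) := by
  have h : Tendsto (fun x : ℝ => |Real.log x * x|) (𝓝[>] 0) (𝓝 0) := by
    simpa using (tendsto_log_mul_rpow_nhdsGT_zero zero_lt_one).abs
  refine squeeze_zero_norm' ?_ h
  filter_upwards [self_mem_nhdsWithin] with x (hx : 0 < x)
  have h₁ : Real.exp (-x) ≤ 1 := Real.exp_le_one_iff.2 (by linarith)
  rw [Real.norm_eq_abs, abs_mul, abs_mul, mul_comm, abs_of_pos hx, abs_of_nonneg (sub_nonneg.2 h₁)]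
  gcongr
  linarith [Real.add_one_le_exp (-x)]

theorem tendsto_expIntE1_add_log :
    Tendsto (fun x : ℝ => expIntE1 x + Real.log x) (𝓝[>] 0)
      (𝓝 (-Real.eulerMascheroniConstant)) := by
  have hcover : AECover (volume.restrict (Ioi (0 : ℝ))) (𝓝[>] 0) fun x : ℝ => Ioi x :=
    aecover_Ioi_of_Ioi (tendsto_id.mono_left nhdsWithin_le_nhds)
  have hint := hcover.integral_tendsto_of_countably_generated integrableOn_log_mul_exp_neg_Ioi
  rw [integral_log_mul_exp_neg_Ioi] at hint
  have hsum := tendsto_one_sub_exp_neg_mul_log_nhdsGT_zero.add hint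
  rw [zero_add] at hsum
  refine hsum.congr' ?_
  filter_upwards [self_mem_nhdsWithin] with x (hx : 0 < x)
  rw [expIntE1_eq_neg_log_mul_exp_add hx, Measure.restrict_restrict measurableSet_Ioi,
    inter_eq_left.2 (Ioi_subset_Ioi hx.le)]
  ring

theorem stmt_15 :
    Filter.Tendsto (fun x : ℝ => expIntE1 x + Real.log x)
      (nhdsWithin 0 (Set.Ioi 0)) (nhds (-Real.eulerMascheroniConstant)) ∧
    Filter.Tendsto (fun x : ℝ => Real.exp (-expIntE1 x) / x)
      (nhdsWithin 0 (Set.Ioi 0)) (nhds (Real.exp Real.eulerMascheroniConstant)) := by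
  refine ⟨tendsto_expIntE1_add_log, ?_⟩
  have h := (Real.continuous_exp.tendsto _).comp tendsto_expIntE1_add_log.neg
  rw [neg_neg] at h
  refine h.congr' ?_
  filter_upwards [self_mem_nhdsWithin] with x (hx : 0 < x)
  rw [Function.comp_apply, neg_add, ← sub_eq_add_neg, Real.exp_sub, Real.exp_log hx]
end

section
/- Define E₁(x) = ∫₁^∞ t⁻¹·e^{−x·t} dt for x > 0, and σ(x) = exp(−E₁(x)). Then x·e^{x}·(1 − σ(x)) tends to 1 as x → +∞. (This is the large-argument asymptotic σ(z) = 1 − (e^{−z}/z)·(1+O(z⁻¹)), which shows that the cutoff factor F_{r,s} in the fermion two-point function tends to 1 in the quantum-field-theory limit, Result 4.2.) -/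
open MeasureTheory Set Filter Topology

lemma integrableOn_expIntE1 {x : ℝ} (hx : 0 < x) :
    IntegrableOn (fun t : ℝ => t⁻¹ * Real.exp (-x * t)) (Ioi 1) := by
  refine (integrableOn_exp_mul_Ioi (neg_lt_zero.mpr hx) 1).mono'
    (by fun_prop : Measurable fun t : ℝ => t⁻¹ * Real.exp (-x * t)).aestronglyMeasurable ?_
  filter_upwards [ae_restrict_mem measurableSet_Ioi] with t ht
  have ht : 1 < t := ht
  rw [Real.norm_of_nonneg (by positivity)]
  exact mul_le_of_le_one_left (Real.exp_pos _).le (inv_le_one_of_one_le₀ ht.le)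

lemma expIntE1_nonneg (x : ℝ) : 0 ≤ expIntE1 x := by
  refine setIntegral_nonneg measurableSet_Ioi fun t ht => ?_
  have ht : 1 < t := ht
  positivity

lemma expIntE1_le {x : ℝ} (hx : 0 < x) : expIntE1 x ≤ Real.exp (-x) / x := by
  have hint : ∫ t in Ioi (1 : ℝ), Real.exp (-x * t) = Real.exp (-x) / x := by
    rw [integral_exp_mul_Ioi (neg_lt_zero.mpr hx), mul_one, neg_div_neg_eq]
  rw [← hint]
  refine setIntegral_mono_on (integrableOn_expIntE1 hx)
    (integrableOn_exp_mul_Ioi (neg_lt_zero.mpr hx) 1) measurableSet_Ioi fun t ht => ?_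
  exact mul_le_of_le_one_left (Real.exp_pos _).le (inv_le_one_of_one_le₀ (le_of_lt ht))

lemma le_expIntE1 {x : ℝ} (hx : 0 < x) : Real.exp (-x) / (x + 1) ≤ expIntE1 x := by
  have hneg : -(x + 1) < 0 := by linarith
  have hint : ∫ t in Ioi (1 : ℝ), Real.exp 1 * Real.exp (-(x + 1) * t) =
      Real.exp (-x) / (x + 1) := by
    rw [integral_const_mul, integral_exp_mul_Ioi hneg, mul_one, neg_div_neg_eq, ← mul_div_assoc,
      ← Real.exp_add]
    ring_nf
  rw [← hint]
  refine setIntegral_mono_on ((integrableOn_exp_mul_Ioi hneg 1).const_mul _)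
    (integrableOn_expIntE1 hx) measurableSet_Ioi fun t ht => ?_
  have ht : 1 < t := ht
  have hexp : Real.exp 1 * Real.exp (-(x + 1) * t) = Real.exp (-(t - 1)) * Real.exp (-x * t) := by
    rw [← Real.exp_add, ← Real.exp_add]
    ring_nf
  rw [hexp, Real.exp_neg]
  gcongr
  linarith [Real.add_one_le_exp (t - 1)]

lemma tendsto_expIntE1_atTop : Tendsto expIntE1 atTop (𝓝 0) := by
  have hlim : Tendsto (fun x : ℝ => Real.exp (-x) / x) atTop (𝓝 0) :=
    Real.tendsto_exp_neg_atTop_nhds_zero.div_atTop tendsto_id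
  refine tendsto_of_tendsto_of_tendsto_of_le_of_le' tendsto_const_nhds hlim
    (Eventually.of_forall expIntE1_nonneg) ?_
  filter_upwards [eventually_gt_atTop 0] with x hx using expIntE1_le hx

lemma mul_exp_mul_expIntE1_le_one {x : ℝ} (hx : 0 < x) :
    x * Real.exp x * expIntE1 x ≤ 1 := by
  calc x * Real.exp x * expIntE1 x ≤ x * Real.exp x * (Real.exp (-x) / x) := by
        gcongr
        exact expIntE1_le hx
    _ = 1 := by
        rw [Real.exp_neg]
        field_simp

lemma div_add_one_le_mul_exp_mul_expIntE1 {x : ℝ} (hx : 0 < x) :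
    x / (x + 1) ≤ x * Real.exp x * expIntE1 x := by
  calc x / (x + 1) = x * Real.exp x * (Real.exp (-x) / (x + 1)) := by
        rw [Real.exp_neg]
        field_simp
    _ ≤ x * Real.exp x * expIntE1 x := by
        gcongr
        exact le_expIntE1 hx

lemma mul_exp_neg_le_one_sub_exp_neg (y : ℝ) : y * Real.exp (-y) ≤ 1 - Real.exp (-y) := by
  have h := mul_le_mul_of_nonneg_right (Real.add_one_le_exp y) (Real.exp_pos (-y)).le
  rw [← Real.exp_add, add_neg_cancel, Real.exp_zero] at h
  linarith

theorem stmt_16 :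
    Filter.Tendsto (fun x : ℝ => x * Real.exp x * (1 - Real.exp (-expIntE1 x)))
      Filter.atTop (nhds 1) := by
  have hfrac : Tendsto (fun x : ℝ => x / (x + 1)) atTop (𝓝 1) := by
    have h : Tendsto (fun x : ℝ => 1 - (x + 1)⁻¹) atTop (𝓝 (1 - 0)) :=
      tendsto_const_nhds.sub
        (tendsto_inv_atTop_zero.comp (tendsto_atTop_add_const_right _ 1 tendsto_id))
    rw [sub_zero] at h
    refine h.congr' ?_
    filter_upwards [eventually_gt_atTop 0] with x hx
    field_simp
    ring
  have hlow : Tendsto (fun x : ℝ => x / (x + 1) * Real.exp (-expIntE1 x)) atTop (𝓝 1) := by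
    have h := hfrac.mul ((Real.continuous_exp.tendsto _).comp tendsto_expIntE1_atTop.neg)
    simpa using h
  refine tendsto_of_tendsto_of_tendsto_of_le_of_le' hlow tendsto_const_nhds ?_ ?_
  · filter_upwards [eventually_gt_atTop 0] with x hx
    calc x / (x + 1) * Real.exp (-expIntE1 x)
        ≤ x * Real.exp x * expIntE1 x * Real.exp (-expIntE1 x) := by
          gcongr
          exact div_add_one_le_mul_exp_mul_expIntE1 hx
      _ = x * Real.exp x * (expIntE1 x * Real.exp (-expIntE1 x)) := mul_assoc _ _ _
      _ ≤ x * Real.exp x * (1 - Real.exp (-expIntE1 x)) := by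
          gcongr
          exact mul_exp_neg_le_one_sub_exp_neg _
  · filter_upwards [eventually_gt_atTop 0] with x hx
    refine le_trans ?_ (mul_exp_mul_expIntE1_le_one hx)
    gcongr
    linarith [Real.add_one_le_exp (-expIntE1 x)]
end
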